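/- Let A be a unital C*-algebra with real rank zero (the invertible self-adjoint elements are dense in the self-adjoint elements of A) and stable rank one (the invertible elements are dense in A). Let n ≥ 2 and d ≥ 2, and let M_n(A) denote the C*-algebra of n×n matrices over A. If Gen_{(d−1)n²+1}(A)_sa is dense in A^{(d−1)n²+1}_sa, then Gen_d(M_n(A))_sa is dense in M_n(A)^d_sa. In other words, if gr(A) ≥ 1 then gr(A ⊗ M_n) ≤ ⌈gr(A)/n²⌉. -/

import Mathlib

/-- The entries of the tuple `a` generate `A` as a C*-algebra: the smallest closed
`*`-subalgebra of `A` containing them is `A` itself. -/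
def Generates {A : Type*} [NonUnitalCStarAlgebra A] {k : ℕ} (a : Fin k → A) : Prop :=
  (NonUnitalStarAlgebra.adjoin ℂ (Set.range a)).topologicalClosure = ⊤

/-- The entries of a tuple of `n × n` matrices over `A` generate `M_n(A)` as a C*-algebra:
the smallest closed `*`-subalgebra containing them is all of `M_n(A)`.  (The product topology
on `M_n(A)` agrees with the topology induced by the unique C*-norm.) -/
def MatGenerates {A : Type*} [CStarAlgebra A] {n k : ℕ}
    (a : Fin k → Matrix (Fin n) (Fin n) A) : Prop :=
  (NonUnitalStarAlgebra.adjoin ℂ (Set.range a)).topologicalClosure = ⊤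

section Subalgebra

variable {M : Type*} [CStarAlgebra M]

theorem StarSubalgebra.exists_inverse_mem (D : StarSubalgebra ℂ M) [IsClosed (D : Set M)]
    {y : M} (hy : y ∈ D) (hu : IsUnit y) : ∃ r ∈ D, y * r = 1 ∧ r * y = 1 := by
  have h : IsUnit (⟨y, hy⟩ : D) := (StarSubalgebra.coe_isUnit (S := D)).1 hu
  obtain ⟨u, hu⟩ := h
  refine ⟨(↑u⁻¹ : D), (↑u⁻¹ : D).2, ?_, ?_⟩
  · have := congrArg (Subtype.val) u.mul_inv
    rw [hu] at this
    exact this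
  · have := congrArg (Subtype.val) u.inv_mul
    rw [hu] at this
    exact this

theorem isSelfAdjoint_of_mul_eq_one {y r : M} (hy : IsSelfAdjoint y) (h : y * r = 1) :
    IsSelfAdjoint r := by
  have h1 : star r * y = 1 := by
    have := congrArg star h
    simpa [hy.star_eq] using this
  exact left_inv_eq_right_inv h1 h

/-- The relative commutant in `D` of a self-adjoint element. -/
def StarSubalgebra.commutant (D : StarSubalgebra ℂ M) (e : M) : StarSubalgebra ℂ M :=
  D ⊓ StarSubalgebra.centralizer ℂ {e}

theorem StarSubalgebra.mem_commutant {D : StarSubalgebra ℂ M} {e x : M} (he : IsSelfAdjoint e) :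
    x ∈ D.commutant e ↔ x ∈ D ∧ e * x = x * e := by
  rw [commutant, StarSubalgebra.mem_inf, StarSubalgebra.mem_centralizer_iff]
  simp [he.star_eq]

theorem StarSubalgebra.commutant_comm (D : StarSubalgebra ℂ M) (e f : M) :
    (D.commutant e).commutant f = (D.commutant f).commutant e :=
  inf_right_comm _ _ _

instance StarSubalgebra.isClosed_commutant (D : StarSubalgebra ℂ M) [hD : IsClosed (D : Set M)]
    (e : M) : IsClosed (D.commutant e : Set M) := by
  rw [commutant, StarSubalgebra.coe_inf, StarSubalgebra.coe_centralizer]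
  exact hD.inter (Set.isClosed_centralizer _)

/-- Real rank zero for a `*`-subalgebra (with units taken in the ambient algebra). -/
def StarSubalgebra.RealRankZero (D : StarSubalgebra ℂ M) : Prop :=
  ∀ x ∈ D, IsSelfAdjoint x → ∀ ε > 0, ∃ y ∈ D, IsSelfAdjoint y ∧ IsUnit y ∧ ‖x - y‖ < ε

set_option maxHeartbeats 1000000 in
/-- The Schur complement with respect to an invertible pivot `m` in the corner of `f`. -/
theorem schur_complement {D : StarSubalgebra ℂ M} {b f m r : M} (hb : b ∈ D) (hbs : IsSelfAdjoint b)
    (hf : IsStarProjection f) (hfD : f ∈ D)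
    (hrD : r ∈ D) (hr : IsSelfAdjoint r) (hmr : m * r = 1)
    (hrm : r * m = 1) (hfm : f * m = m * f) (hpiv : f * m = f * b * f) :
    ∃ L ∈ D, ∃ L' ∈ D, ∃ y ∈ D.commutant f, L * L' = 1 ∧ L' * L = 1 ∧ IsSelfAdjoint y ∧
      b = L * y * star L ∧
      (1 - f) * y * (1 - f) = (1 - f) * b * (1 - f) - (1 - f) * b * f * r * (f * b * (1 - f)) := by
  have hff : f * f = f := hf.isIdempotentElem
  have hfs : star f = f := hf.isSelfAdjoint
  have hfr : f * r = r * f := by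
    calc f * r = (r * m) * f * r := by rw [hrm, one_mul]
      _ = r * (m * f) * r := by noncomm_ring
      _ = r * f * (m * r) := by rw [← hfm]; noncomm_ring
      _ = r * f := by rw [hmr, mul_one]
  have hone : (1 : M) ∈ D := one_mem D
  obtain ⟨t, ht⟩ : ∃ t, t = (1 - f) * b * f * r := ⟨_, rfl⟩
  have htD : t ∈ D := ht ▸ mul_mem (mul_mem (mul_mem (sub_mem hone hfD) hb) hfD) hrD
  have hft : f * t = 0 := by
    rw [ht]
    calc f * ((1 - f) * b * f * r) = (f - f * f) * b * f * r := by noncomm_ring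
      _ = 0 := by rw [hff]; simp
  have htf : t * f = t := by
    rw [ht]
    calc ((1 - f) * b * f * r) * f = (1 - f) * b * f * (r * f) := by noncomm_ring
      _ = (1 - f) * b * (f * f) * r := by rw [← hfr]; noncomm_ring
      _ = _ := by rw [hff]
  have htt : t * t = 0 := by
    calc t * t = (t * f) * t := by rw [htf]
      _ = t * (f * t) := mul_assoc _ _ _
      _ = 0 := by rw [hft, mul_zero]
  have hst : star t = r * f * b * (1 - f) := by
    rw [ht]; simp [hr.star_eq, hfs, hbs.star_eq, mul_assoc]
  have hsft : f * star t = star t := by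
    have := congrArg star htf; simpa [hfs] using this
  have hstf : star t * f = 0 := by
    have := congrArg star hft; simpa [hfs] using this
  have hst2 : star t * star t = 0 := by
    have := congrArg star htt; simpa using this
  have hbt : f * b * star t = f * b * (1 - f) := by
    rw [← hsft, hst]
    calc f * b * (f * (r * f * b * (1 - f))) = (f * b * f) * r * f * b * (1 - f) := by noncomm_ring
      _ = f * (m * r) * f * b * (1 - f) := by rw [← hpiv]; noncomm_ring
      _ = (f * f) * b * (1 - f) := by rw [hmr]; noncomm_ring
      _ = _ := by rw [hff]
  have htb : t * b * f = (1 - f) * b * f := by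
    have := congrArg star hbt
    rwa [star_mul, star_mul, star_mul, star_mul, star_star, hfs, hbs.star_eq, star_sub, star_one,
      hfs, ← mul_assoc, ← mul_assoc] at this
  have hy : IsSelfAdjoint ((1 - t) * b * (1 - star t)) := by
    simpa only [star_sub, star_one] using hbs.conjugate (1 - t)
  have hfy : f * ((1 - t) * b * (1 - star t)) = f * b * f := by
    calc f * ((1 - t) * b * (1 - star t))
        = (f - f * t) * b * (1 - star t) := by noncomm_ring
      _ = f * b - f * b * star t := by rw [hft]; noncomm_ring
      _ = _ := by rw [hbt]; noncomm_ring
  have hyf : ((1 - t) * b * (1 - star t)) * f = f * b * f := by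
    have := congrArg star hfy
    rwa [star_mul, hy.star_eq, hfs, star_mul, star_mul, hfs, hbs.star_eq, ← mul_assoc] at this
  refine ⟨1 + t, add_mem hone htD, 1 - t, sub_mem hone htD, (1 - t) * b * (1 - star t),
    (StarSubalgebra.mem_commutant hf.isSelfAdjoint).2 ⟨?_, by rw [hfy, hyf]⟩, ?_, ?_, hy, ?_, ?_⟩
  · exact mul_mem (mul_mem (sub_mem hone htD) hb) (sub_mem hone (star_mem htD))
  · calc (1 + t) * (1 - t) = 1 - t * t := by noncomm_ring
      _ = 1 := by rw [htt, sub_zero]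
  · calc (1 - t) * (1 + t) = 1 - t * t := by noncomm_ring
      _ = 1 := by rw [htt, sub_zero]
  · have h1 : (1 + t) * (1 - t) = 1 := by
      calc (1 + t) * (1 - t) = 1 - t * t := by noncomm_ring
        _ = 1 := by rw [htt, sub_zero]
    have h2 : (1 - star t) * (1 + star t) = 1 := by
      calc (1 - star t) * (1 + star t) = 1 - star t * star t := by noncomm_ring
        _ = 1 := by rw [hst2, sub_zero]
    rw [star_add, star_one]
    calc b = ((1 + t) * (1 - t)) * b * ((1 - star t) * (1 + star t)) := by rw [h1, h2]; simp
      _ = _ := by simp only [mul_assoc]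
  · have h1 : (1 - f) * ((1 - t) * b * (1 - star t)) * (1 - f)
        = (1 - t) * b * (1 - star t) - f * b * f := by
      have hc : ∀ y : M, (1 - f) * y * (1 - f) = y - f * y - y * f + f * y * f := fun y => by
        noncomm_ring
      rw [hc, hfy, hyf, mul_assoc (f * b) f f, hff]
      abel
    have h3 : t * b * star t = (1 - f) * b * star t := by
      rw [← hsft, ← mul_assoc, htb]; noncomm_ring
    have h4 : (1 - f) * b * star t = t * (b * (1 - f)) := by
      rw [hst, ht]
      calc _ = (1 - f) * b * (r * f) * b * (1 - f) := by noncomm_ring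
        _ = _ := by rw [← hfr]; noncomm_ring
    have h5 : b * star t = (1 - f) * b * star t + f * b * (1 - f) := by
      rw [← hbt]; noncomm_ring
    have h6 : t * b = t * (b * (1 - f)) + (1 - f) * b * f := by
      rw [← htb]; noncomm_ring
    rw [h1]
    calc _ = b - t * b - b * star t + t * b * star t - f * b * f := by noncomm_ring
      _ = b - (1 - f) * b * f - f * b * (1 - f) - t * (b * (1 - f)) - f * b * f := by
        rw [h3, h6, h5, h4]; noncomm_ring
      _ = b - (1 - f) * b * f - f * b * (1 - f) - (t * f) * (b * (1 - f)) - f * b * f := by rw [htf]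
      _ = _ := by rw [ht]; noncomm_ring

end Subalgebra

section RealRankZero

variable {M : Type*} [CStarAlgebra M]

theorem IsStarProjection.norm_le_one' {q : M} (hq : IsStarProjection q) : ‖q‖ ≤ 1 := by
  have h : ‖q‖ * ‖q‖ = ‖q‖ := by
    have := CStarRing.norm_star_mul_self (x := q)
    rwa [hq.isSelfAdjoint.star_eq, hq.isIdempotentElem.eq, eq_comm] at this
  nlinarith [norm_nonneg q]

theorem norm_proj_mul_mul_proj_le {p q : M} (hp : IsStarProjection p) (hq : IsStarProjection q)
    (x : M) : ‖p * x * q‖ ≤ ‖x‖ := by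
  calc ‖p * x * q‖ ≤ ‖p‖ * ‖x‖ * ‖q‖ := norm_mul₃_le
    _ ≤ 1 * ‖x‖ * 1 := by
      gcongr
      · exact hp.norm_le_one'
      · exact hq.norm_le_one'
    _ = ‖x‖ := by ring

/-- An element near `1` has an inverse of norm at most `2`. -/
theorem norm_inverse_le_two {m r : M} (hm : ‖m - 1‖ ≤ 1 / 2) (h : m * r = 1) : ‖r‖ ≤ 2 := by
  have h1 : r = 1 - (m - 1) * r := by rw [sub_mul, h]; simp
  have h2 : ‖r‖ ≤ ‖(1 : M)‖ + 1 / 2 * ‖r‖ := by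
    calc ‖r‖ = ‖1 - (m - 1) * r‖ := by rw [← h1]
      _ ≤ ‖(1 : M)‖ + ‖(m - 1) * r‖ := norm_sub_le _ _
      _ ≤ ‖(1 : M)‖ + ‖m - 1‖ * ‖r‖ := by gcongr; exact norm_mul_le _ _
      _ ≤ _ := by gcongr
  have h3 : ‖(1 : M)‖ ≤ 1 := IsStarProjection.norm_le_one' (.one M)
  linarith

theorem StarSubalgebra.RealRankZero.corner {D : StarSubalgebra ℂ M} [IsClosed (D : Set M)]
    (hD : D.RealRankZero) {q : M} (hq : IsStarProjection q) (hqD : q ∈ D) {x : M}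
    (hx : x ∈ D.commutant q) (hxs : IsSelfAdjoint x) {ε : ℝ} (hε : 0 < ε) :
    ∃ y ∈ D.commutant q, IsSelfAdjoint y ∧ IsUnit y ∧ ‖q * y * q - q * x * q‖ < ε := by
  obtain ⟨hxD, hxq⟩ := (StarSubalgebra.mem_commutant hq.isSelfAdjoint).1 hx
  have hqs := hq.isSelfAdjoint.star_eq
  have hqq : q * q = q := hq.isIdempotentElem
  obtain ⟨η, hη0, hη1, hη2⟩ : ∃ η : ℝ, 0 < η ∧ η ≤ 1 / 2 ∧ 2 * η < ε :=
    ⟨min (1 / 2) (ε / 4), by positivity, min_le_left _ _, by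
      have := min_le_right (1 / 2) (ε / 4); linarith⟩
  obtain ⟨f, hfdef⟩ : ∃ f, f = 1 - q := ⟨_, rfl⟩
  have hqf : q = 1 - f := by rw [hfdef]; simp
  have hf : IsStarProjection f := hfdef ▸ hq.one_sub
  have hff : f * f = f := hf.isIdempotentElem
  have hfq : f * q = 0 := by rw [hfdef, sub_mul, hqq]; simp
  have hqf0 : q * f = 0 := by rw [hfdef, mul_sub, hqq]; simp
  have hfD : f ∈ D := hfdef ▸ sub_mem (one_mem D) hqD
  have hwD : q * x * q + f ∈ D := add_mem (mul_mem (mul_mem hqD hxD) hqD) hfD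
  have hws : IsSelfAdjoint (q * x * q + f) := by
    refine IsSelfAdjoint.add ?_ hf.isSelfAdjoint
    have := hxs.conjugate q
    rwa [hqs] at this
  obtain ⟨b, hbD, hbs, hbu, hb⟩ := hD _ hwD hws η hη0
  have hfw : f * (q * x * q + f) * f = f := by
    calc f * (q * x * q + f) * f = (f * q) * x * q * f + f * f * f := by noncomm_ring
      _ = f := by rw [hfq, hff, hff]; simp
  have hqw : q * (q * x * q + f) * f = 0 := by
    calc q * (q * x * q + f) * f = q * q * x * (q * f) + q * f * f := by noncomm_ring
      _ = 0 := by rw [hqf0]; simp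
  have hqw2 : q * (q * x * q + f) * q = q * x * q := by
    calc q * (q * x * q + f) * q = (q * q) * x * (q * q) + q * (f * q) := by noncomm_ring
      _ = _ := by rw [hqq, hfq]; simp
  obtain ⟨m, hm⟩ : ∃ m, m = f * b * f + q := ⟨_, rfl⟩
  have hmD : m ∈ D := hm ▸ add_mem (mul_mem (mul_mem hfD hbD) hfD) hqD
  have hms : IsSelfAdjoint m := by
    rw [hm]
    refine IsSelfAdjoint.add ?_ hq.isSelfAdjoint
    have := hbs.conjugate f
    rwa [hf.isSelfAdjoint.star_eq] at this
  have hm1 : m - 1 = f * (b - (q * x * q + f)) * f := by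
    rw [mul_sub, sub_mul, hfw, hm, hqf]; noncomm_ring
  have hm1n : ‖m - 1‖ ≤ η := by
    rw [hm1]
    refine (norm_proj_mul_mul_proj_le hf hf _).trans ?_
    rw [norm_sub_rev]; exact hb.le
  have hmu : IsUnit m := by
    have := isUnit_one_sub_of_norm_lt_one (x := 1 - m) (by rw [norm_sub_rev]; linarith)
    simpa using this
  obtain ⟨r, hrD, hmr, hrm⟩ := D.exists_inverse_mem hmD hmu
  have hfm : f * m = f * b * f := by
    rw [hm, mul_add, hfq, ← mul_assoc, ← mul_assoc, hff]; simp
  have hmf : m * f = f * b * f := by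
    rw [hm, add_mul, hqf0, mul_assoc, hff]; simp
  obtain ⟨L, hL, L', hL', y, hy, hLL', hL'L, hys, hby, hpy⟩ :=
    schur_complement hbD hbs hf hfD hrD (isSelfAdjoint_of_mul_eq_one hms hmr) hmr hrm
      (hfm.trans hmf.symm) hfm
  rw [← hqf] at hpy
  obtain ⟨hyD, hyf⟩ := (StarSubalgebra.mem_commutant hf.isSelfAdjoint).1 hy
  refine ⟨y, (StarSubalgebra.mem_commutant hq.isSelfAdjoint).2 ⟨hyD, ?_⟩, hys, ?_, ?_⟩
  · rw [hqf, sub_mul, mul_sub, hyf]; simp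
  · have hLu : IsUnit L := ⟨⟨L, L', hLL', hL'L⟩, rfl⟩
    have h1 : IsUnit (L * y * star L) := hby ▸ hbu
    exact hLu.mul_left_iff.1 (hLu.star.mul_right_iff.1 h1)
  · have e1 : ‖q * b * q - q * x * q‖ ≤ η := by
      rw [← hqw2, ← sub_mul, ← mul_sub]
      refine (norm_proj_mul_mul_proj_le hq hq _).trans ?_
      rw [norm_sub_rev]; exact hb.le
    have e2 : ‖q * b * f‖ ≤ η := by
      rw [← sub_zero (q * b * f), ← hqw, ← sub_mul, ← mul_sub]
      refine (norm_proj_mul_mul_proj_le hq hf _).trans ?_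
      rw [norm_sub_rev]; exact hb.le
    have e3 : ‖f * b * q‖ ≤ η := by
      rw [← norm_star]
      simpa [hqs, hf.isSelfAdjoint.star_eq, hbs.star_eq, mul_assoc] using e2
    have e4 : ‖r‖ ≤ 2 := norm_inverse_le_two (hm1n.trans hη1) hmr
    calc ‖q * y * q - q * x * q‖
        = ‖(q * b * q - q * x * q) - q * b * f * r * (f * b * q)‖ := by rw [hpy]; congr 1; abel
      _ ≤ ‖q * b * q - q * x * q‖ + ‖q * b * f * r * (f * b * q)‖ := norm_sub_le _ _
      _ ≤ η + ‖q * b * f‖ * ‖r‖ * ‖f * b * q‖ := by gcongr; exact norm_mul₃_le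
      _ ≤ η + η * 2 * η := by gcongr
      _ ≤ 2 * η := by nlinarith
      _ < ε := hη2

theorem StarSubalgebra.RealRankZero.commutant {D : StarSubalgebra ℂ M} [IsClosed (D : Set M)]
    (hD : D.RealRankZero) {q : M} (hq : IsStarProjection q) (hqD : q ∈ D) :
    (D.commutant q).RealRankZero := by
  intro x hx hxs ε hε
  obtain ⟨y, hy, hys, hyu, hyx⟩ := hD.corner hq hqD hx hxs (half_pos hε)
  have hcomm : ∀ z ∈ D.commutant q, q * z = z * q := fun z hz =>
    ((StarSubalgebra.mem_commutant hq.isSelfAdjoint).1 hz).2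
  have hx' : x ∈ D.commutant (1 - q) := by
    rw [StarSubalgebra.mem_commutant hq.one_sub.isSelfAdjoint]
    refine ⟨((StarSubalgebra.mem_commutant hq.isSelfAdjoint).1 hx).1, ?_⟩
    rw [sub_mul, mul_sub, hcomm x hx]; simp
  obtain ⟨z, hz', hzs, hzu, hzx⟩ := hD.corner hq.one_sub (sub_mem (one_mem D) hqD) hx' hxs
    (half_pos hε)
  have hz : z ∈ D.commutant q := by
    rw [StarSubalgebra.mem_commutant hq.one_sub.isSelfAdjoint] at hz'
    rw [StarSubalgebra.mem_commutant hq.isSelfAdjoint]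
    refine ⟨hz'.1, ?_⟩
    have := hz'.2
    rw [sub_mul, mul_sub, one_mul, mul_one] at this
    exact sub_right_injective this
  have hqc : q ∈ D.commutant q := (StarSubalgebra.mem_commutant hq.isSelfAdjoint).2 ⟨hqD, rfl⟩
  have hq1 : (1 - q) ∈ D.commutant q := sub_mem (one_mem _) hqc
  have hqq : q * q = q := hq.isIdempotentElem
  have hqs := hq.isSelfAdjoint.star_eq
  have hq0 : q * (1 - q) = 0 := by rw [mul_sub, hqq]; simp
  have h0q : (1 - q) * q = 0 := by rw [sub_mul, hqq]; simp
  have hqq' : (1 - q) * (1 - q) = 1 - q := hq.one_sub.isIdempotentElem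
  have key : ∀ a ∈ D.commutant q, ∀ b ∈ D.commutant q, ∀ c d : M,
      (q * a + (1 - q) * b) * (q * c + (1 - q) * d) = q * (a * c) + (1 - q) * (b * d) := by
    intro a ha b hb c d
    have ha' := hcomm a ha
    have hb' : (1 - q) * b = b * (1 - q) := by rw [sub_mul, mul_sub, hcomm b hb]; simp
    calc (q * a + (1 - q) * b) * (q * c + (1 - q) * d)
        = a * (q * q) * c + a * (q * (1 - q)) * d + b * ((1 - q) * q) * c
          + b * ((1 - q) * (1 - q)) * d := by
          rw [ha', hb']; simp only [mul_assoc, add_mul, mul_add]; abel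
      _ = (a * q) * c + (b * (1 - q)) * d := by rw [hqq, hqq', hq0, h0q]; simp
      _ = _ := by rw [← ha', ← hb', mul_assoc, mul_assoc]
  refine ⟨q * y + (1 - q) * z, add_mem (mul_mem hqc hy) (mul_mem hq1 hz), ?_, ?_, ?_⟩
  · rw [isSelfAdjoint_iff]
    simp only [star_add, star_mul, star_sub, star_one, hqs, hys.star_eq, hzs.star_eq]
    rw [hcomm y hy, sub_mul, mul_sub, hcomm z hz]; simp
  · obtain ⟨r, hr, h1, h2⟩ := (D.commutant q).exists_inverse_mem hy hyu
    obtain ⟨t, ht, h3, h4⟩ := (D.commutant q).exists_inverse_mem hz hzu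
    refine ⟨⟨_, q * r + (1 - q) * t, ?_, ?_⟩, rfl⟩
    · rw [key y hy z hz, h1, h3]; simp
    · rw [key r hr t ht, h2, h4]; simp
  · have e : ∀ w ∈ D.commutant q, q * w * q = q * w := fun w hw => by
      rw [mul_assoc, ← hcomm w hw, ← mul_assoc, hqq]
    have e' : ∀ w ∈ D.commutant q, (1 - q) * w * (1 - q) = (1 - q) * w := fun w hw => by
      have : (1 - q) * w = w * (1 - q) := by rw [sub_mul, mul_sub, hcomm w hw]; simp
      rw [this, mul_assoc, hqq']
    rw [e y hy, e x hx] at hyx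
    rw [e' z hz, e' x hx] at hzx
    calc ‖x - (q * y + (1 - q) * z)‖
        = ‖(q * y - q * x) + ((1 - q) * z - (1 - q) * x)‖ := by
          rw [← norm_neg]; congr 1; noncomm_ring
      _ ≤ _ := norm_add_le _ _
      _ < ε := by linarith

/-- Approximate `L y L*` decomposition with `y` commuting with a given projection. -/
theorem exists_approx_congruence {D : StarSubalgebra ℂ M} [IsClosed (D : Set M)] {e : M}
    (he : IsStarProjection e) (heD : e ∈ D) (hD : (D.commutant e).RealRankZero) {a : M}
    (ha : a ∈ D) (has : IsSelfAdjoint a) {ε : ℝ} (hε : 0 < ε) :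
    ∃ L ∈ D, ∃ L' ∈ D, ∃ y ∈ D.commutant e, L * L' = 1 ∧ L' * L = 1 ∧ IsSelfAdjoint y ∧
      IsUnit y ∧ ‖a - L * y * star L‖ < ε := by
  have hes := he.isSelfAdjoint.star_eq
  have hee : e * e = e := he.isIdempotentElem
  have hcomm : ∀ z ∈ D.commutant e, e * z = z * e := fun z hz =>
    ((StarSubalgebra.mem_commutant he.isSelfAdjoint).1 hz).2
  have heae : e * a * e ∈ D.commutant e := by
    rw [StarSubalgebra.mem_commutant he.isSelfAdjoint]
    refine ⟨mul_mem (mul_mem heD ha) heD, ?_⟩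
    rw [← mul_assoc, ← mul_assoc, hee, mul_assoc _ e e, hee]
  have heae_s : IsSelfAdjoint (e * a * e) := by
    have := has.conjugate e
    rwa [hes] at this
  obtain ⟨m, hm, hms, hmu, hma⟩ := hD _ heae heae_s (ε / 2) (half_pos hε)
  obtain ⟨r, hr, hmr, hrm⟩ := (D.commutant e).exists_inverse_mem hm hmu
  have hle : ∀ z ∈ D.commutant e, z ∈ D := fun z hz =>
    ((StarSubalgebra.mem_commutant he.isSelfAdjoint).1 hz).1
  obtain ⟨b, hb⟩ : ∃ b, b = a + (e * m * e - e * a * e) := ⟨_, rfl⟩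
  have hbD : b ∈ D := by
    rw [hb]
    exact add_mem ha (sub_mem (mul_mem (mul_mem heD (hle m hm)) heD) (hle _ heae))
  have hbs : IsSelfAdjoint b := by
    rw [hb]
    refine has.add (IsSelfAdjoint.sub ?_ heae_s)
    have := hms.conjugate e
    rwa [hes] at this
  have h3 : ∀ z : M, e * (e * z * e) * e = e * z * e := fun z => by
    calc e * (e * z * e) * e = (e * e) * z * (e * e) := by noncomm_ring
      _ = _ := by rw [hee]
  have hem : e * m = e * b * e := by
    rw [hb, mul_add, add_mul, mul_sub, sub_mul, h3, h3, mul_assoc e m e, ← hcomm m hm,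
      ← mul_assoc, hee]
    abel
  obtain ⟨L, hL, L', hL', y, hy, hLL', hL'L, hys, hby, -⟩ :=
    schur_complement hbD hbs he heD (hle r hr) (isSelfAdjoint_of_mul_eq_one hms hmr) hmr hrm
      (hcomm m hm) hem
  have hδ : 0 < ε / 2 / (‖L‖ * ‖L‖ + 1) := by positivity
  obtain ⟨z, hz, hzs, hzu, hyz⟩ := hD y hy hys _ hδ
  refine ⟨L, hL, L', hL', z, hz, hLL', hL'L, hzs, hzu, ?_⟩
  have e1 : ‖a - b‖ < ε / 2 := by
    have : a - b = e * (e * a * e - m) * e := by rw [hb, mul_sub, sub_mul, h3]; abel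
    rw [this]
    exact (norm_proj_mul_mul_proj_le he he _).trans_lt hma
  have e2 : ‖b - L * z * star L‖ ≤ ε / 2 := by
    have : b - L * z * star L = L * (y - z) * star L := by
      rw [mul_sub, sub_mul, ← hby]
    rw [this]
    calc ‖L * (y - z) * star L‖ ≤ ‖L‖ * ‖y - z‖ * ‖star L‖ := norm_mul₃_le
      _ = ‖y - z‖ * (‖L‖ * ‖L‖) := by rw [norm_star]; ring
      _ ≤ ε / 2 / (‖L‖ * ‖L‖ + 1) * (‖L‖ * ‖L‖ + 1) := by gcongr; linarith
      _ = ε / 2 := by field_simp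
  calc ‖a - L * z * star L‖ = ‖(a - b) + (b - L * z * star L)‖ := by congr 1; abel
    _ ≤ _ := norm_add_le _ _
    _ < ε := by linarith

theorem StarSubalgebra.RealRankZero.of_commutant {D : StarSubalgebra ℂ M} [IsClosed (D : Set M)]
    {e : M} (he : IsStarProjection e) (heD : e ∈ D) (hD : (D.commutant e).RealRankZero) :
    D.RealRankZero := by
  intro x hx hxs ε hε
  obtain ⟨L, hL, L', hL', y, hy, hLL', hL'L, hys, hyu, h⟩ :=
    exists_approx_congruence he heD hD hx hxs hε
  have hLu : IsUnit L := ⟨⟨L, L', hLL', hL'L⟩, rfl⟩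
  exact ⟨L * y * star L, mul_mem (mul_mem hL ((StarSubalgebra.mem_commutant he.isSelfAdjoint).1
    hy).1) (star_mem hL), hys.conjugate L, (hLu.mul hyu).mul hLu.star, h⟩

end RealRankZero

section Polar

variable {M : Type*} [CStarAlgebra M]

theorem exists_resolvent (w : M) : ∃ v : M, (1 + star w * w) * v = 1 ∧ v * (1 + star w * w) = 1 ∧
    ‖star w * w * v‖ ≤ 1 := by
  have hs : IsSelfAdjoint (star w * w) := .star_mul_self w
  have h0 := spectrum_star_mul_self_nonneg (b := w)
  obtain ⟨h, hh⟩ : ∃ h, h = star w * w := ⟨_, rfl⟩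
  rw [← hh] at hs h0 ⊢
  have hc : ContinuousOn (fun t : ℝ => (1 + t)⁻¹) (spectrum ℝ h) :=
    ContinuousOn.inv₀ (by fun_prop) fun t ht => by have := h0 t ht; positivity
  obtain ⟨v, hv⟩ : ∃ v, v = cfc (fun t : ℝ => (1 + t)⁻¹) h := ⟨_, rfl⟩
  have e1 : 1 + h = cfc (fun t : ℝ => 1 + t) h := by
    rw [cfc_const_add 1 (fun t : ℝ => t) h, cfc_id' ℝ h]; simp
  have e3 : (1 + h) * v = 1 := by
    rw [e1, hv, ← cfc_mul _ _ h (by fun_prop) hc, ← cfc_one ℝ h]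
    refine cfc_congr fun t ht => ?_
    have := h0 t ht
    simp only [Pi.one_apply]
    field_simp
  have hcm : Commute v (1 + h) := by
    rw [hv]; exact (Commute.one_right _).add_right ((Commute.refl h).cfc_real _)
  refine ⟨v, e3, hcm.eq.trans e3, ?_⟩
  have : h * v = cfc (fun t : ℝ => t * (1 + t)⁻¹) h := by
    rw [cfc_mul _ _ h (by fun_prop) hc, cfc_id' ℝ h, hv]
  rw [this]
  refine norm_cfc_le zero_le_one fun t ht => ?_
  have := h0 t ht
  rw [Real.norm_of_nonneg (by positivity), ← div_eq_mul_inv, div_le_one (by positivity)]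
  linarith

/-- Polar decomposition of an invertible element. -/
theorem exists_polar {z : M} (hz : IsUnit z) :
    ∃ p v : M, IsSelfAdjoint p ∧ IsSelfAdjoint v ∧ p * v = 1 ∧ v * p = 1 ∧ z * v ∈ unitary M ∧
      (∃ c : ℝ, ‖p - c • (1 : M)‖ < c) ∧
      (∀ D : StarSubalgebra ℂ M, IsClosed (D : Set M) → z ∈ D → v ∈ D) ∧
      ∀ s : M, Commute (star z * z) s → Commute v s := by
  have hs : IsSelfAdjoint (star z * z) := .star_mul_self z
  have h0 := spectrum_star_mul_self_nonneg (b := z)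
  have hu : IsUnit (star z * z) := hz.star.mul hz
  obtain ⟨h, hh⟩ : ∃ h, h = star z * z := ⟨_, rfl⟩
  rw [← hh] at hs h0 hu ⊢
  have hpos : ∀ t ∈ spectrum ℝ h, 0 < t := fun t ht => (h0 t ht).lt_of_ne fun h' =>
    spectrum.zero_notMem ℝ hu (h' ▸ ht)
  have hc : ContinuousOn (fun t : ℝ => (√t)⁻¹) (spectrum ℝ h) :=
    ContinuousOn.inv₀ (by fun_prop) fun t ht => (Real.sqrt_pos.2 (hpos t ht)).ne'
  have hc' : ContinuousOn (fun t : ℝ => √t) (spectrum ℝ h) := by fun_prop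
  obtain ⟨p, hp⟩ : ∃ p, p = cfc (fun t : ℝ => √t) h := ⟨_, rfl⟩
  obtain ⟨v, hv⟩ : ∃ v, v = cfc (fun t : ℝ => (√t)⁻¹) h := ⟨_, rfl⟩
  have hvs : IsSelfAdjoint v := hv ▸ cfc_predicate _ h
  have hpv : p * v = 1 := by
    rw [hp, hv, ← cfc_mul _ _ h hc' hc, ← cfc_one ℝ h]
    refine cfc_congr fun t ht => ?_
    have := Real.sqrt_pos.2 (hpos t ht)
    simp only [Pi.one_apply]
    field_simp
  have hvp : v * p = 1 := by
    rw [← hpv, hv, hp]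
    exact (cfc_commute_cfc _ _ h).eq
  have hpp : h = p * p := by
    rw [hp, ← cfc_mul _ _ h hc' hc']
    conv_lhs => rw [← cfc_id' ℝ h]
    exact cfc_congr fun t ht => (Real.mul_self_sqrt (h0 t ht)).symm
  have h1 : star (z * v) * (z * v) = 1 := by
    calc star (z * v) * (z * v) = v * (star z * z) * v := by
          rw [star_mul, hvs.star_eq]; simp only [mul_assoc]
      _ = (v * p) * (p * v) := by rw [← hh, hpp]; simp only [mul_assoc]
      _ = 1 := by rw [hpv, hvp, one_mul]
  have hvu : IsUnit (z * v) := hz.mul ⟨⟨v, p, hvp, hpv⟩, rfl⟩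
  refine ⟨p, v, hp ▸ cfc_predicate _ h, hvs, hpv, hvp, ?_, ?_, ?_, ?_⟩
  · rw [Unitary.mem_iff]
    refine ⟨h1, ?_⟩
    obtain ⟨u, hu⟩ := hvu
    rw [← hu] at h1 ⊢
    rw [← u.inv_eq_of_mul_eq_one_left h1, Units.mul_inv]
  · refine ⟨√(‖h‖ * ‖(1 : M)‖) + 1, ?_⟩
    have : p - (√(‖h‖ * ‖(1 : M)‖) + 1) • (1 : M) =
        cfc (fun t : ℝ => √t - (√(‖h‖ * ‖(1 : M)‖) + 1)) h := by
      rw [cfc_sub _ _ h hc' (by fun_prop), cfc_const _ h, ← hp, Algebra.algebraMap_eq_smul_one]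
    rw [this]
    refine norm_cfc_lt (by positivity) fun t ht => ?_
    have h3 := Real.sqrt_pos.2 (hpos t ht)
    have h4 : √t ≤ √(‖h‖ * ‖(1 : M)‖) :=
      Real.sqrt_le_sqrt ((le_abs_self t).trans (spectrum.norm_le_norm_mul_of_mem ht))
    rw [Real.norm_eq_abs, abs_lt]
    constructor <;> linarith
  · intro D hD hzD
    rw [hv]
    exact cfc_mem (s := D) _ (hh ▸ mul_mem (star_mem hzD) hzD)
  · intro s hsz
    rw [hv]
    exact hsz.cfc_real _

theorem IsStarProjection.isSelfAdjoint_two_nsmul_sub_one {p : M} (hp : IsStarProjection p) :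
    IsSelfAdjoint (2 • p - 1) := by
  rw [isSelfAdjoint_iff, star_sub, star_nsmul, hp.isSelfAdjoint.star_eq, star_one]

theorem exists_unitary_conj_of_congruence {D : StarSubalgebra ℂ M} [IsClosed (D : Set M)]
    {e p L L' y : M} (he : IsSelfAdjoint e) (hp : IsStarProjection p) (hpD : p ∈ D)
    (hL : L ∈ D) (hy : y ∈ D.commutant e) (hLL' : L * L' = 1) (hL'L : L' * L = 1)
    (hys : IsSelfAdjoint y) (hyu : IsUnit y) (hn : ‖(2 • p - 1) - L * y * star L‖ < 1) :
    ∃ u ∈ D, u ∈ unitary M ∧ u * p * star u ∈ D.commutant e := by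
  have hpp : p * p = p := hp.isIdempotentElem
  have hle : ∀ z ∈ D.commutant e, z ∈ D := fun z hz => ((StarSubalgebra.mem_commutant he).1 hz).1
  obtain ⟨s, hs⟩ : ∃ s, s = 2 • p - 1 := ⟨_, rfl⟩
  have hsD : s ∈ D := hs ▸ sub_mem (nsmul_mem hpD 2) (one_mem D)
  have hss : s * s = 1 := by
    rw [hs]
    calc (2 • p - 1) * (2 • p - 1) = 4 • (p * p) - 4 • p + 1 := by noncomm_ring
      _ = 1 := by rw [hpp]; simp
  have hsa : IsSelfAdjoint s := by
    rw [hs]; exact hp.isSelfAdjoint_two_nsmul_sub_one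
  have hs1 : ‖s‖ ≤ 1 := by
    have := CStarRing.norm_star_mul_self (x := s)
    rw [hsa.star_eq, hss] at this
    have h1 := IsStarProjection.norm_le_one' (IsStarProjection.one M)
    nlinarith [norm_nonneg s]
  rw [← hs] at hn
  have hne : ∀ t ∈ spectrum ℝ y, t ≠ 0 := fun t ht h' => spectrum.zero_notMem ℝ hyu (h' ▸ ht)
  have hci : ContinuousOn (fun t : ℝ => |t|⁻¹) (spectrum ℝ y) :=
    ContinuousOn.inv₀ (by fun_prop) fun t ht => abs_ne_zero.2 (hne t ht)
  have hcr : ContinuousOn (fun t : ℝ => √(|t|⁻¹)) (spectrum ℝ y) := hci.sqrt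
  have hcs : ContinuousOn (fun t : ℝ => t * |t|⁻¹) (spectrum ℝ y) := continuousOn_id.mul hci
  obtain ⟨s', hs'⟩ : ∃ s', s' = cfc (fun t : ℝ => t * |t|⁻¹) y := ⟨_, rfl⟩
  obtain ⟨r, hr⟩ : ∃ r, r = cfc (fun t : ℝ => √(|t|⁻¹)) y := ⟨_, rfl⟩
  have hs'e : s' ∈ D.commutant e := hs' ▸ cfc_mem (s := D.commutant e) _ hy
  have hrs : IsSelfAdjoint r := hr ▸ cfc_predicate _ y
  have hs'a : IsSelfAdjoint s' := hs' ▸ cfc_predicate _ y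
  have hss' : s' * s' = 1 := by
    rw [hs', ← cfc_mul _ _ y hcs hcs, ← cfc_one ℝ y]
    refine cfc_congr fun t ht => ?_
    have h1 : |t| ≠ 0 := abs_ne_zero.2 (hne t ht)
    simp only [Pi.one_apply]
    field_simp
    simp
  have hyrr : y * (r * r) = s' := by
    rw [hr, hs', ← cfc_mul _ _ y hcr hcr]
    have := cfc_mul (fun t : ℝ => t) (fun t => √(|t|⁻¹) * √(|t|⁻¹)) y (by fun_prop) (hcr.mul hcr)
    rw [cfc_id' ℝ y] at this
    refine this.symm.trans ?_
    refine cfc_congr fun t ht => ?_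
    rw [Real.mul_self_sqrt (by positivity)]
  obtain ⟨w, hw⟩ : ∃ w, w = r * L' := ⟨_, rfl⟩
  obtain ⟨c, hc⟩ : ∃ c, c = L * y * star L := ⟨_, rfl⟩
  rw [← hc] at hn
  have hch : c * (star w * w) = L * s' * L' := by
    calc c * (star w * w) = L * y * (star (L' * L)) * (r * r) * L' := by
          rw [hc, hw, star_mul, star_mul, hrs.star_eq]; simp only [mul_assoc]
      _ = L * (y * (r * r)) * L' := by rw [hL'L, star_one, mul_one]; simp only [mul_assoc]
      _ = _ := by rw [hyrr]
  obtain ⟨v, hv1, hv2, hv3⟩ := exists_resolvent w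
  obtain ⟨h, hh⟩ : ∃ h, h = star w * w := ⟨_, rfl⟩
  rw [← hh] at hv1 hv2 hv3 hch
  obtain ⟨F, hF⟩ : ∃ F, F = s * (s - c) := ⟨_, rfl⟩
  have hFn : ‖F‖ < 1 := by
    rw [hF]
    calc ‖s * (s - c)‖ ≤ ‖s‖ * ‖s - c‖ := norm_mul_le _ _
      _ ≤ 1 * ‖s - c‖ := by gcongr
      _ < 1 := by rwa [one_mul]
  have hsc : s * c = 1 - F := by rw [hF, mul_sub, hss]; simp
  obtain ⟨z, hz⟩ : ∃ z, z = L + s * L * s' := ⟨_, rfl⟩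
  have hzD : z ∈ D := hz ▸ add_mem hL (mul_mem (mul_mem hsD hL) (hle _ hs'e))
  have hz' : z = (1 - F * (h * v)) * (1 + h) * L := by
    have h1 : (h * v) * (1 + h) = h := by rw [mul_assoc, hv2, mul_one]
    calc z = L + s * (c * h) * L := by
          rw [hz, hch]; simp only [mul_assoc]; rw [hL'L, mul_one]
      _ = (1 + (s * c) * h) * L := by noncomm_ring
      _ = ((1 + h) - F * h) * L := by rw [hsc]; noncomm_ring
      _ = ((1 + h) - F * ((h * v) * (1 + h))) * L := by rw [h1]
      _ = _ := by noncomm_ring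
  have hzu : IsUnit z := by
    rw [hz']
    refine (IsUnit.mul ?_ ⟨⟨_, v, hv1, hv2⟩, rfl⟩).mul ⟨⟨L, L', hLL', hL'L⟩, rfl⟩
    refine isUnit_one_sub_of_norm_lt_one ?_
    calc ‖F * (h * v)‖ ≤ ‖F‖ * ‖h * v‖ := norm_mul_le _ _
      _ ≤ ‖F‖ * 1 := by gcongr
      _ < 1 := by rwa [mul_one]
  have hszz : s * z = z * s' := by
    rw [hz, mul_add, add_mul, ← mul_assoc, ← mul_assoc, hss, one_mul, mul_assoc (s * L), hss',
      mul_one, add_comm]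
  have hzs : star z * s = s' * star z := by
    have := congrArg star hszz
    simpa [hsa.star_eq, hs'a.star_eq] using this
  obtain ⟨-, v', -, hvs, -, -, huz, -, hvD, hvc⟩ := exists_polar hzu
  have hcomm : Commute v' s' := hvc s' (by
    change star z * z * s' = s' * (star z * z)
    rw [mul_assoc, ← hszz, ← mul_assoc, hzs, mul_assoc])
  have hv'D := hvD D ‹_› hzD
  refine ⟨star (z * v'), star_mem (mul_mem hzD hv'D), Unitary.star_mem huz, ?_⟩
  rw [star_star]
  have h1 : star (z * v') * s * (z * v') = s' := by
    calc star (z * v') * s * (z * v') = star (z * v') * ((s * z) * v') := by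
          simp only [mul_assoc]
      _ = star (z * v') * (z * (s' * v')) := by rw [hszz, mul_assoc]
      _ = (star (z * v') * (z * v')) * s' := by rw [← hcomm.eq]; simp only [mul_assoc]
      _ = s' := by rw [(Unitary.mem_iff.1 huz).1, one_mul]
  have h2 : p = (2⁻¹ : ℂ) • (s + 1) := by
    rw [hs, sub_add_cancel, ← Nat.cast_smul_eq_nsmul ℂ, smul_smul]; norm_num
  have h3 : star (z * v') * p * (z * v') = (2⁻¹ : ℂ) • (s' + 1) := by
    rw [h2, mul_smul_comm, smul_mul_assoc, mul_add, add_mul, h1, mul_one,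
      (Unitary.mem_iff.1 huz).1]
  rw [h3]
  exact (D.commutant e).smul_mem (add_mem hs'e (one_mem _)) _

theorem exists_unitary_conj_mem_commutant {D : StarSubalgebra ℂ M} [IsClosed (D : Set M)]
    {e p : M} (he : IsStarProjection e) (heD : e ∈ D) (hD : (D.commutant e).RealRankZero)
    (hp : IsStarProjection p) (hpD : p ∈ D) :
    ∃ u ∈ D, u ∈ unitary M ∧ u * p * star u ∈ D.commutant e := by
  obtain ⟨L, hL, L', -, y, hy, hLL', hL'L, hys, hyu, h⟩ :=
    exists_approx_congruence he heD hD (sub_mem (nsmul_mem hpD 2) (one_mem D))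
      hp.isSelfAdjoint_two_nsmul_sub_one one_pos
  exact exists_unitary_conj_of_congruence he.isSelfAdjoint hp hpD hL hy hLL' hL'L hys hyu h

/-- Commuting projections can be moved simultaneously into the commutant of a projection. -/
theorem exists_unitary_conj_list_mem_commutant {e : M} (he : IsStarProjection e) (l : List M) :
    ∀ (D : StarSubalgebra ℂ M) [IsClosed (D : Set M)], e ∈ D → (D.commutant e).RealRankZero →
      (∀ p ∈ l, IsStarProjection p ∧ p ∈ D) → (∀ p ∈ l, ∀ q ∈ l, p * q = q * p) →
      ∃ u ∈ D, u ∈ unitary M ∧ ∀ p ∈ l, u * p * star u ∈ D.commutant e := by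
  generalize hl : l.length = N
  induction N generalizing l with
  | zero =>
    intro D _ _ _ _ _
    refine ⟨1, one_mem D, one_mem _, ?_⟩
    rw [List.length_eq_zero_iff] at hl
    simp [hl]
  | succ N ih =>
    intro D _ heD hD hlp hlc
    match l, hl with
    | p :: l, hl =>
      obtain ⟨u, huD, hu, hup⟩ := exists_unitary_conj_mem_commutant he heD hD
        (hlp p (by simp)).1 (hlp p (by simp)).2
      obtain ⟨h1, h2⟩ := Unitary.mem_iff.1 hu
      have hconj : ∀ x y : M, (u * x * star u) * (u * y * star u) = u * (x * y) * star u := by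
        intro x y
        calc (u * x * star u) * (u * y * star u) = u * x * (star u * u) * y * star u := by
              simp only [mul_assoc]
          _ = _ := by rw [h1, mul_one, mul_assoc u]
      have hproj : ∀ x, IsStarProjection x → IsStarProjection (u * x * star u) := fun x hx =>
        ⟨by rw [IsIdempotentElem, hconj, hx.isIdempotentElem.eq], hx.isSelfAdjoint.conjugate u⟩
      obtain ⟨q, hq⟩ : ∃ q, q = u * p * star u := ⟨_, rfl⟩
      have hqp : IsStarProjection q := hq ▸ hproj p (hlp p (by simp)).1
      rw [← hq] at hup
      obtain ⟨hqD, hqe⟩ := (StarSubalgebra.mem_commutant he.isSelfAdjoint).1 hup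
      have hRR : ((D.commutant q).commutant e).RealRankZero := by
        rw [StarSubalgebra.commutant_comm]
        exact hD.commutant hqp hup
      obtain ⟨w, hwD, hw, hwl⟩ := ih (l.map fun x => u * x * star u) (by simpa using hl)
        (D.commutant q) ((StarSubalgebra.mem_commutant hqp.isSelfAdjoint).2 ⟨heD, hqe.symm⟩) hRR
        (by
          intro x hx
          obtain ⟨x, hx', rfl⟩ := List.mem_map.1 hx
          have hx'' := hlp x (List.mem_cons_of_mem _ hx')
          refine ⟨hproj _ hx''.1, (StarSubalgebra.mem_commutant hqp.isSelfAdjoint).2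
            ⟨mul_mem (mul_mem huD hx''.2) (star_mem huD), ?_⟩⟩
          rw [hq, hconj, hconj, hlc p (by simp) x (List.mem_cons_of_mem _ hx')])
        (by
          intro x hx y hy
          obtain ⟨x, hx', rfl⟩ := List.mem_map.1 hx
          obtain ⟨y, hy', rfl⟩ := List.mem_map.1 hy
          rw [hconj, hconj, hlc x (List.mem_cons_of_mem _ hx') y (List.mem_cons_of_mem _ hy')])
      obtain ⟨hwD', hwq⟩ := (StarSubalgebra.mem_commutant hqp.isSelfAdjoint).1 hwD
      have hexp : ∀ x, (w * u) * x * star (w * u) = w * (u * x * star u) * star w := fun x => by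
        rw [star_mul]; simp only [mul_assoc]
      refine ⟨w * u, mul_mem hwD' huD, mul_mem hw hu, fun x hx => ?_⟩
      rw [hexp]
      rcases List.mem_cons.1 hx with rfl | hx
      · rw [← hq, ← hwq, mul_assoc, (Unitary.mem_iff.1 hw).2, mul_one]
        exact hup
      · have h3 := hwl _ (List.mem_map_of_mem (f := fun x => u * x * star u) hx)
        rw [StarSubalgebra.commutant_comm] at h3
        exact ((StarSubalgebra.mem_commutant hqp.isSelfAdjoint).1 h3).1

end Polar

section Diagonalization

variable {M : Type*} [CStarAlgebra M]

theorem StarSubalgebra.RealRankZero.exists_spectrum_avoiding {D : StarSubalgebra ℂ M}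
    (hD : D.RealRankZero) {x : M} (hx : x ∈ D) (hxs : IsSelfAdjoint x) (F : Finset ℝ) :
    ∀ ε > 0, ∃ y ∈ D, IsSelfAdjoint y ∧ ‖x - y‖ < ε ∧ ∀ f ∈ F, f ∉ spectrum ℝ y := by
  induction F using Finset.induction_on with
  | empty => exact fun ε hε => ⟨x, hx, hxs, by simpa using hε, by simp⟩
  | insert f F _ ih =>
    intro ε hε
    obtain ⟨y, hy, hys, hxy, hyF⟩ := ih (ε / 2) (half_pos hε)
    have hopen : IsOpen {z : M | ∀ t ∈ F, IsUnit (algebraMap ℝ M t - z)} := by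
      have : {z : M | ∀ t ∈ F, IsUnit (algebraMap ℝ M t - z)} =
          ⋂ t ∈ F, (fun z => algebraMap ℝ M t - z) ⁻¹' {u | IsUnit u} := by ext; simp
      rw [this]
      exact isOpen_biInter_finset fun t _ => Units.isOpen.preimage (by fun_prop)
    obtain ⟨δ, hδ, hball⟩ := Metric.isOpen_iff.1 hopen y
      fun t ht => spectrum.notMem_iff.1 (hyF t ht)
    have hf : algebraMap ℝ M f ∈ D := by
      rw [IsScalarTower.algebraMap_apply ℝ ℂ M]; exact D.algebraMap_mem _
    have hfs : IsSelfAdjoint (algebraMap ℝ M f) := .algebraMap M (.all f)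
    obtain ⟨z, hz, hzs, hzu, hyz⟩ := hD (y - algebraMap ℝ M f) (sub_mem hy hf) (hys.sub hfs)
      (min δ (ε / 2)) (lt_min hδ (half_pos hε))
    have h1 : ‖y - (z + algebraMap ℝ M f)‖ < min δ (ε / 2) := by
      rwa [add_comm, ← sub_sub]
    refine ⟨z + algebraMap ℝ M f, add_mem hz hf, hzs.add hfs, ?_, ?_⟩
    · calc ‖x - (z + algebraMap ℝ M f)‖ = ‖(x - y) + (y - (z + algebraMap ℝ M f))‖ := by
            congr 1; abel
        _ ≤ _ := norm_add_le _ _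
        _ < ε / 2 + ε / 2 := add_lt_add hxy (h1.trans_le (min_le_right _ _))
        _ = ε := add_halves ε
    · intro t ht
      rw [spectrum.notMem_iff]
      rcases Finset.mem_insert.1 ht with rfl | ht
      · simpa using hzu.neg
      · refine hball ?_ t ht
        rw [Metric.mem_ball, dist_eq_norm, norm_sub_rev]
        exact h1.trans_le (min_le_left _ _)

theorem abs_sub_sum_indicator_le {r : ℝ} (h0 : 0 ≤ r) :
    ∀ N : ℕ, r ≤ N → |r - ∑ k ∈ Finset.range N, if (k : ℝ) < r then (1 : ℝ) else 0| ≤ 1 := by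
  intro N
  induction N with
  | zero => intro h; simp at h; simp [le_antisymm h h0]
  | succ N ih =>
    intro h
    rcases le_or_gt r N with h' | h'
    · rw [Finset.sum_range_succ, if_neg h'.not_gt, add_zero]
      exact ih h'
    · have : ∑ k ∈ Finset.range (N + 1), (if (k : ℝ) < r then (1 : ℝ) else 0) = N + 1 := by
        rw [Finset.sum_congr rfl (g := fun _ => (1 : ℝ))]
        · simp
        · intro k hk
          have : (k : ℝ) ≤ N := by exact_mod_cast Nat.lt_succ_iff.1 (Finset.mem_range.1 hk)
          rw [if_pos (this.trans_lt h')]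
      rw [this, abs_le]
      push_cast at h
      constructor <;> linarith

/-- In real rank zero, a self-adjoint element is close to one with spectrum in an arithmetic
progression. -/
theorem StarSubalgebra.RealRankZero.exists_near_sum_projections {D : StarSubalgebra ℂ M}
    [IsClosed (D : Set M)] (hD : D.RealRankZero) {x : M} (hx : x ∈ D) (hxs : IsSelfAdjoint x)
    {η : ℝ} (hη : 0 < η) (θ : ℝ) :
    ∃ b : M, IsSelfAdjoint b ∧ ‖x - b‖ < 2 * η ∧
      (∀ t ∈ spectrum ℝ b, ∃ z : ℤ, t = θ + η * z) ∧
      ∃ (l : List M) (t₀ : ℝ), (∀ p ∈ l, IsStarProjection p ∧ p ∈ D) ∧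
        (∀ p ∈ l, ∀ q ∈ l, p * q = q * p) ∧ b = t₀ • (1 : M) + η • l.sum := by
  obtain ⟨R, hR⟩ : ∃ R, R = (‖x‖ + η) * ‖(1 : M)‖ := ⟨_, rfl⟩
  obtain ⟨m, hm⟩ : ∃ m : ℤ, θ + η * m ≤ -R :=
    ⟨⌊(-R - θ) / η⌋, by
      have := Int.floor_le ((-R - θ) / η)
      rw [le_div_iff₀ hη] at this
      linarith⟩
  obtain ⟨t₀, ht₀⟩ : ∃ t₀, t₀ = θ + η * m := ⟨_, rfl⟩
  obtain ⟨N, hN⟩ : ∃ N : ℕ, R ≤ t₀ + N * η :=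
    ⟨⌈(R - t₀) / η⌉₊, by
      have := Nat.le_ceil ((R - t₀) / η)
      rw [div_le_iff₀ hη] at this
      linarith⟩
  obtain ⟨y, hy, hys, hxy, hyF⟩ := hD.exists_spectrum_avoiding hx hxs
    ((Finset.range N).image fun k : ℕ => t₀ + k * η) η hη
  have hspec : ∀ t ∈ spectrum ℝ y, t₀ ≤ t ∧ t ≤ t₀ + N * η := by
    intro t ht
    have h1 := spectrum.norm_le_norm_mul_of_mem ht
    have h2 : ‖y‖ ≤ ‖x‖ + η := by
      have : ‖y‖ ≤ ‖x‖ + ‖x - y‖ := by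
        calc ‖y‖ = ‖x - (x - y)‖ := by congr 1; abel
          _ ≤ _ := norm_sub_le _ _
      linarith
    have h3 : |t| ≤ R := by
      rw [hR]; exact h1.trans (by gcongr)
    rw [abs_le] at h3
    rw [← ht₀] at hm
    constructor <;> linarith
  obtain ⟨χ, hχ⟩ : ∃ χ : ℕ → ℝ → ℝ, χ = fun (k : ℕ) t => if t₀ + k * η < t then 1 else 0 := ⟨_, rfl⟩
  have hχc : ∀ k ∈ Finset.range N, ContinuousOn (χ k) (spectrum ℝ y) := by
    intro k hk
    have hk' := hyF _ (Finset.mem_image_of_mem (fun k : ℕ => t₀ + k * η) hk)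
    intro t ht
    have hne : t ≠ t₀ + k * η := fun h => hk' (h ▸ ht)
    refine ContinuousAt.continuousWithinAt ?_
    rw [hχ]
    rcases lt_or_gt_of_ne hne with h | h
    · refine (continuousAt_const (y := (0 : ℝ))).congr ?_
      filter_upwards [eventually_lt_nhds h] with s hs
      rw [if_neg hs.not_gt]
    · refine (continuousAt_const (y := (1 : ℝ))).congr ?_
      filter_upwards [eventually_gt_nhds h] with s hs
      rw [if_pos hs]
  obtain ⟨g, hg⟩ : ∃ g : ℝ → ℝ, g = fun t => t₀ + η * ∑ k ∈ Finset.range N, χ k t := ⟨_, rfl⟩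
  have hsc : ContinuousOn (fun t => ∑ k ∈ Finset.range N, χ k t) (spectrum ℝ y) :=
    continuousOn_finsetSum _ hχc
  have hgc : ContinuousOn g (spectrum ℝ y) := by
    rw [hg]; exact continuousOn_const.add (continuousOn_const.mul hsc)
  refine ⟨cfc g y, cfc_predicate _ y, ?_, ?_,
    (List.range N).map fun k => cfc (χ k) y, t₀, ?_, ?_, ?_⟩
  · have h1 : ‖y - cfc g y‖ ≤ η := by
      have : y - cfc g y = cfc (fun t => t - g t) y := by
        rw [cfc_sub _ _ y (by fun_prop) hgc, cfc_id' ℝ y]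
      rw [this]
      refine norm_cfc_le hη.le fun t ht => ?_
      obtain ⟨h2, h3⟩ := hspec t ht
      have h4 := abs_sub_sum_indicator_le (r := (t - t₀) / η)
        (div_nonneg (by linarith) hη.le) N (by rw [div_le_iff₀ hη]; linarith)
      have h5 : t - g t = η * ((t - t₀) / η -
          ∑ k ∈ Finset.range N, if (k : ℝ) < (t - t₀) / η then (1 : ℝ) else 0) := by
        have : ∀ k : ℕ, (if (k : ℝ) < (t - t₀) / η then (1 : ℝ) else 0) = χ k t := fun k => by
          rw [hχ]
          simp only [lt_div_iff₀ hη, lt_sub_iff_add_lt']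
        simp only [this, hg]
        field_simp
        ring
      rw [Real.norm_eq_abs, h5, abs_mul, abs_of_pos hη]
      nlinarith
    calc ‖x - cfc g y‖ = ‖(x - y) + (y - cfc g y)‖ := by congr 1; abel
      _ ≤ _ := norm_add_le _ _
      _ < 2 * η := by linarith
  · rw [cfc_map_spectrum g y]
    rintro _ ⟨t, -, rfl⟩
    have : ∃ j : ℤ, ∑ k ∈ Finset.range N, χ k t = j :=
      ⟨∑ k ∈ Finset.range N, if t₀ + k * η < t then 1 else 0, by
        push_cast; rw [hχ]⟩
    obtain ⟨j, hj⟩ := this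
    refine ⟨m + j, ?_⟩
    simp only [hg, hj]
    rw [ht₀]; push_cast; ring
  · intro p hp
    obtain ⟨k, hk, rfl⟩ := List.mem_map.1 hp
    refine ⟨⟨?_, cfc_predicate _ y⟩, cfc_mem (s := D) _ hy⟩
    have hk' := hχc k (Finset.mem_range.2 (List.mem_range.1 hk))
    rw [IsIdempotentElem, ← cfc_mul _ _ y hk' hk']
    refine cfc_congr fun t _ => ?_
    simp [hχ]
  · intro p hp q hq
    obtain ⟨k, -, rfl⟩ := List.mem_map.1 hp
    obtain ⟨j, -, rfl⟩ := List.mem_map.1 hq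
    exact (cfc_commute_cfc _ _ y).eq
  · have : ((List.range N).map fun k => cfc (χ k) y).sum = ∑ k ∈ Finset.range N, cfc (χ k) y :=
      rfl
    have hsc' : ContinuousOn (∑ k ∈ Finset.range N, χ k) (spectrum ℝ y) := by
      convert hsc using 1; ext t; simp
    have hg' : g = fun t => t₀ + η • (∑ k ∈ Finset.range N, χ k) t := by
      rw [hg]; ext t; simp
    rw [this, ← cfc_sum χ y _ hχc, hg',
      cfc_const_add t₀ (fun t => η • (∑ k ∈ Finset.range N, χ k) t) y (hsc'.const_smul η),
      cfc_smul η _ y hsc', Algebra.algebraMap_eq_smul_one]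

theorem StarSubalgebra.mem_foldl_commutant {es : List M} (hes : ∀ e ∈ es, IsSelfAdjoint e) :
    ∀ {D : StarSubalgebra ℂ M} {x : M}, x ∈ es.foldl StarSubalgebra.commutant D ↔
      x ∈ D ∧ ∀ e ∈ es, e * x = x * e := by
  induction es with
  | nil => simp
  | cons e es ih =>
    intro D x
    rw [List.foldl_cons, ih fun f hf => hes f (List.mem_cons_of_mem _ hf),
      StarSubalgebra.mem_commutant (hes e (by simp))]
    simp [and_assoc]

theorem exists_unitary_conj_near_commutant {D : StarSubalgebra ℂ M} [IsClosed (D : Set M)]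
    {e : M} (he : IsStarProjection e) (heD : e ∈ D) (hD : (D.commutant e).RealRankZero)
    {x : M} (hx : x ∈ D) (hxs : IsSelfAdjoint x) {ε : ℝ} (hε : 0 < ε) :
    ∃ u ∈ D, u ∈ unitary M ∧ ∃ y ∈ D.commutant e, IsSelfAdjoint y ∧ ‖u * x * star u - y‖ < ε := by
  obtain ⟨b, hbs, hxb, -, l, t₀, hl, hlc, hb⟩ :=
    (StarSubalgebra.RealRankZero.of_commutant he heD hD).exists_near_sum_projections hx hxs
      (half_pos hε) 0
  obtain ⟨u, huD, hu, hul⟩ := exists_unitary_conj_list_mem_commutant he l D heD hD hl hlc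
  refine ⟨u, huD, hu, u * b * star u, ?_, hbs.conjugate u, ?_⟩
  · have hsum : ∀ l : List M, (∀ p ∈ l, u * p * star u ∈ D.commutant e) →
        u * l.sum * star u ∈ D.commutant e := by
      intro l
      induction l with
      | nil => simp
      | cons p l ih =>
        intro h
        rw [List.sum_cons, mul_add, add_mul]
        exact add_mem (h p (by simp)) (ih fun q hq => h q (List.mem_cons_of_mem _ hq))
    have hsm : ∀ (r : ℝ) (z : M), z ∈ D.commutant e → r • z ∈ D.commutant e := fun r z hz => by
      rw [← Complex.coe_smul]; exact (D.commutant e).smul_mem hz _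
    rw [hb, mul_add, add_mul, mul_smul_comm, mul_smul_comm, smul_mul_assoc, smul_mul_assoc,
      mul_one, (Unitary.mem_iff.1 hu).2]
    exact add_mem (hsm _ _ (one_mem _)) (hsm _ _ (hsum l hul))
  · rw [← sub_mul, ← mul_sub]
    calc ‖u * (x - b) * star u‖ = ‖x - b‖ := by
          rw [CStarRing.norm_mul_mem_unitary _ (Unitary.star_mem hu),
            CStarRing.norm_mem_unitary_mul _ hu]
      _ < ε := by linarith

theorem exists_unitary_conj_near_foldl_commutant {es : List M}
    (hes : ∀ e ∈ es, IsStarProjection e) (hc : ∀ e ∈ es, ∀ f ∈ es, e * f = f * e) :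
    ∀ (D : StarSubalgebra ℂ M) [IsClosed (D : Set M)], (∀ e ∈ es, e ∈ D) →
      (es.foldl StarSubalgebra.commutant D).RealRankZero →
      D.RealRankZero ∧ ∀ x ∈ D, IsSelfAdjoint x → ∀ ε > 0, ∃ u ∈ unitary M,
        u ∈ D ∧ ∃ y ∈ es.foldl StarSubalgebra.commutant D, IsSelfAdjoint y ∧
          ‖u * x * star u - y‖ < ε := by
  induction es with
  | nil =>
    intro D _ _ h
    exact ⟨h, fun x hx hxs ε hε => ⟨1, one_mem _, one_mem _, x, hx, hxs, by simpa using hε⟩⟩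
  | cons e es ih =>
    intro D _ hD h
    have he := hes e (by simp)
    have heD := hD e (by simp)
    obtain ⟨h1, h2⟩ := ih (fun f hf => hes f (List.mem_cons_of_mem _ hf))
      (fun f hf g hg => hc f (List.mem_cons_of_mem _ hf) g (List.mem_cons_of_mem _ hg))
      (D.commutant e) (fun f hf => (StarSubalgebra.mem_commutant he.isSelfAdjoint).2
        ⟨hD f (List.mem_cons_of_mem _ hf), hc e (by simp) f (List.mem_cons_of_mem _ hf)⟩) h
    refine ⟨.of_commutant he heD h1, fun x hx hxs ε hε => ?_⟩
    obtain ⟨u, huD, hu, y, hy, hys, hxy⟩ :=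
      exists_unitary_conj_near_commutant he heD h1 hx hxs (half_pos hε)
    obtain ⟨w, hw, hwD, z, hz, hzs, hyz⟩ := h2 y hy hys _ (half_pos hε)
    refine ⟨w * u, mul_mem hw hu,
      mul_mem ((StarSubalgebra.mem_commutant he.isSelfAdjoint).1 hwD).1 huD, z, hz, hzs, ?_⟩
    calc ‖w * u * x * star (w * u) - z‖
        = ‖w * (u * x * star u - y) * star w + (w * y * star w - z)‖ := by
          rw [star_mul]; congr 1; noncomm_ring
      _ ≤ ‖w * (u * x * star u - y) * star w‖ + ‖w * y * star w - z‖ := norm_add_le _ _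
      _ = ‖u * x * star u - y‖ + ‖w * y * star w - z‖ := by
          rw [CStarRing.norm_mul_mem_unitary _ (Unitary.star_mem hw),
            CStarRing.norm_mem_unitary_mul _ hw]
      _ < ε := by linarith

end Diagonalization

section MatrixAlgebra

attribute [local instance] CStarAlgebra.spectralOrder CStarAlgebra.spectralOrderedRing

variable {A : Type*} [CStarAlgebra A] {n : ℕ}

theorem exists_norm_lt_of_entries (n : ℕ) (A : Type*) [CStarAlgebra A] {ε : ℝ} (hε : 0 < ε) :
    ∃ δ > 0, ∀ x : CStarMatrix (Fin n) (Fin n) A, (∀ i j, ‖x i j‖ < δ) → ‖x‖ < ε := by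
  have h : ∀ᶠ x : Matrix (Fin n) (Fin n) A in nhds 0, ‖CStarMatrix.ofMatrix x‖ < ε := by
    have h1 : ∀ᶠ x : CStarMatrix (Fin n) (Fin n) A in nhds 0, ‖x‖ < ε := by
      have : Filter.Tendsto (fun x : CStarMatrix (Fin n) (Fin n) A => ‖x‖) (nhds 0) (nhds 0) := by
        simpa using (continuous_norm (E := CStarMatrix (Fin n) (Fin n) A)).tendsto 0
      exact this.eventually (gt_mem_nhds hε)
    exact h1
  have h2 : ∀ᶠ x : Fin n → Fin n → A in nhds 0, ‖CStarMatrix.ofMatrix (Matrix.of x)‖ < ε := h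
  obtain ⟨δ, hδ, h3⟩ := Metric.eventually_nhds_iff.1 h2
  refine ⟨δ, hδ, fun x hx => h3 (y := fun i j => x i j) ?_⟩
  rw [dist_pi_lt_iff hδ]
  intro i
  rw [dist_pi_lt_iff hδ]
  intro j
  simpa [dist_eq_norm] using hx i j

/-- The diagonal embedding. -/
def diagHom (A : Type*) [CStarAlgebra A] (n : ℕ) :
    (Fin n → A) →⋆ₐ[ℂ] CStarMatrix (Fin n) (Fin n) A where
  toFun c := CStarMatrix.ofMatrix (Matrix.diagonal c)
  map_one' := Matrix.diagonal_one
  map_mul' c d := (Matrix.diagonal_mul_diagonal' c d).symm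
  map_zero' := Matrix.diagonal_zero
  map_add' c d := (Matrix.diagonal_add c d).symm
  commutes' r := (Matrix.algebraMap_eq_diagonal r).symm
  map_star' c := (Matrix.diagonal_conjTranspose c).symm

theorem diagHom_apply (c : Fin n → A) (i j : Fin n) :
    diagHom A n c i j = if i = j then c i else 0 := rfl

theorem diagHom_mul_apply (c : Fin n → A) (x : CStarMatrix (Fin n) (Fin n) A) (i j : Fin n) :
    (diagHom A n c * x) i j = c i * x i j := Matrix.diagonal_mul _ _ _ _

theorem mul_diagHom_apply (c : Fin n → A) (x : CStarMatrix (Fin n) (Fin n) A) (i j : Fin n) :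
    (x * diagHom A n c) i j = x i j * c j := Matrix.mul_diagonal _ _ _ _

theorem diagHom_mem_unitary {v : Fin n → A} (hv : ∀ i, v i ∈ unitary A) :
    diagHom A n v ∈ unitary (CStarMatrix (Fin n) (Fin n) A) := by
  rw [Unitary.mem_iff, ← map_star, ← map_mul, ← map_mul]
  have h1 : star v * v = 1 := funext fun i => (Unitary.mem_iff.1 (hv i)).1
  have h2 : v * star v = 1 := funext fun i => (Unitary.mem_iff.1 (hv i)).2
  rw [h1, h2, map_one]
  exact ⟨rfl, rfl⟩

theorem exists_unitary_conj_near_diagonal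
    (hrr : ∀ a : A, IsSelfAdjoint a → a ∈ closure {x : A | IsSelfAdjoint x ∧ IsUnit x})
    (x : CStarMatrix (Fin n) (Fin n) A) (hx : IsSelfAdjoint x) {ε : ℝ} (hε : 0 < ε) :
    ∃ u ∈ unitary (CStarMatrix (Fin n) (Fin n) A), ∃ c : Fin n → A, (∀ i, IsSelfAdjoint (c i)) ∧
      ‖u * x * star u - diagHom A n c‖ < ε := by
  obtain ⟨e, he⟩ : ∃ e : Fin n → CStarMatrix (Fin n) (Fin n) A,
    e = fun k => diagHom A n (Pi.single k 1) := ⟨_, rfl⟩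
  have hproj : ∀ k, IsStarProjection (e k) := fun k => by
    rw [he]
    refine ⟨?_, ?_⟩
    · rw [IsIdempotentElem, ← map_mul, ← Pi.single_mul, one_mul]
    · rw [isSelfAdjoint_iff, ← map_star, ← Pi.single_star, star_one]
  have hcomm : ∀ k l, e k * e l = e l * e k := fun k l => by
    rw [he, ← map_mul, ← map_mul]
    congr 1
    ext i
    by_cases h1 : i = k <;> by_cases h2 : i = l <;> simp [Pi.single_apply, h1, h2]
  obtain ⟨es, hes⟩ : ∃ es, es = (List.finRange n).map e := ⟨_, rfl⟩
  have hmem : ∀ f, f ∈ es ↔ ∃ k, e k = f := fun f => by rw [hes]; simp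
  have hfold : ∀ y, y ∈ es.foldl StarSubalgebra.commutant
      (⊤ : StarSubalgebra ℂ (CStarMatrix (Fin n) (Fin n) A)) → ∃ c, y = diagHom A n c := by
    intro y hy
    rw [StarSubalgebra.mem_foldl_commutant fun f hf => by
      obtain ⟨k, rfl⟩ := (hmem f).1 hf; exact (hproj k).isSelfAdjoint] at hy
    refine ⟨fun i => y i i, CStarMatrix.ext fun i j => ?_⟩
    rw [diagHom_apply]
    split_ifs with hij
    · rw [hij]
    · have h1 := congrFun (congrFun (hy.2 (e i) ((hmem _).2 ⟨i, rfl⟩)) i) j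
      rw [he, diagHom_mul_apply, mul_diagHom_apply] at h1
      simpa [Pi.single_apply, Ne.symm hij] using h1
  have hfold' : ∀ c, diagHom A n c ∈ es.foldl StarSubalgebra.commutant
      (⊤ : StarSubalgebra ℂ (CStarMatrix (Fin n) (Fin n) A)) := by
    intro c
    rw [StarSubalgebra.mem_foldl_commutant fun f hf => by
      obtain ⟨k, rfl⟩ := (hmem f).1 hf; exact (hproj k).isSelfAdjoint]
    refine ⟨StarSubalgebra.mem_top, fun f hf => ?_⟩
    obtain ⟨k, rfl⟩ := (hmem f).1 hf
    rw [he, ← map_mul, ← map_mul]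
    congr 1
    ext i
    by_cases h1 : i = k <;> simp [h1]
  have hsa : ∀ c, IsSelfAdjoint (diagHom A n c) → ∀ i, IsSelfAdjoint (c i) := fun c hc i => by
    have h1 := congrFun (congrFun hc.star_eq i) i
    rw [← map_star, diagHom_apply, diagHom_apply, if_pos rfl, if_pos rfl] at h1
    exact h1
  have hRR : (es.foldl StarSubalgebra.commutant
      (⊤ : StarSubalgebra ℂ (CStarMatrix (Fin n) (Fin n) A))).RealRankZero := by
    intro y hy hys δ hδ
    obtain ⟨c, rfl⟩ := hfold y hy
    obtain ⟨δ', hδ', h⟩ := exists_norm_lt_of_entries n A hδ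
    choose b hb hcb using fun i => Metric.mem_closure_iff.1 (hrr (c i) (hsa c hys i)) δ' hδ'
    refine ⟨diagHom A n b, hfold' b, ?_, ?_, ?_⟩
    · rw [isSelfAdjoint_iff, ← map_star]
      congr 1
      exact funext fun i => (hb i).1.star_eq
    · exact IsUnit.map (diagHom A n) (Pi.isUnit_iff.2 fun i => (hb i).2)
    · rw [← map_sub]
      refine h _ fun i j => ?_
      rw [diagHom_apply]
      split_ifs
      · rw [Pi.sub_apply, ← dist_eq_norm]; exact hcb i
      · simpa using hδ'
  have : IsClosed ((⊤ : StarSubalgebra ℂ (CStarMatrix (Fin n) (Fin n) A)) :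
    Set (CStarMatrix (Fin n) (Fin n) A)) := by simp
  obtain ⟨-, h⟩ := exists_unitary_conj_near_foldl_commutant (es := es)
    (fun f hf => by obtain ⟨k, rfl⟩ := (hmem f).1 hf; exact hproj k)
    (fun f hf g hg => by
      obtain ⟨k, rfl⟩ := (hmem f).1 hf
      obtain ⟨l, rfl⟩ := (hmem g).1 hg
      exact hcomm k l) ⊤ (fun _ _ => StarSubalgebra.mem_top) hRR
  obtain ⟨u, hu, -, y, hy, hys, hxy⟩ := h x StarSubalgebra.mem_top hx ε hε
  obtain ⟨c, rfl⟩ := hfold y hy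
  exact ⟨u, hu, c, hsa c hys, hxy⟩

/-- After conjugating by a diagonal unitary, the superdiagonal becomes positive and invertible
up to a small perturbation. -/
theorem exists_diagonal_unitary_conj_near (hsr : Dense {x : A | IsUnit x})
    (x : CStarMatrix (Fin (n + 1)) (Fin (n + 1)) A) (hx : IsSelfAdjoint x) {ε : ℝ} (hε : 0 < ε) :
    ∃ v : Fin (n + 1) → A, (∀ i, v i ∈ unitary A) ∧
      ∃ y : CStarMatrix (Fin (n + 1)) (Fin (n + 1)) A, IsSelfAdjoint y ∧
        ‖diagHom A (n + 1) v * x * star (diagHom A (n + 1) v) - y‖ < ε ∧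
        ∀ i : Fin n, IsSelfAdjoint (y i.castSucc i.succ) ∧
          ∃ c : ℝ, ‖y i.castSucc i.succ - c • (1 : A)‖ < c := by
  obtain ⟨δ, hδ, h⟩ := exists_norm_lt_of_entries (n + 1) A hε
  choose z hz hxz using fun i : Fin n => Metric.mem_closure_iff.1 (hsr (x i.castSucc i.succ)) δ hδ
  choose p q hp hq hpq hqp hu hpos _ _ using fun i => exists_polar (hz i)
  obtain ⟨v, hv⟩ : ∃ v : Fin (n + 1) → A, v = Fin.induction 1 fun i w => w * (z i * q i) :=
    ⟨_, rfl⟩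
  have hv0 : v 0 = 1 := by rw [hv]; rfl
  have hvs : ∀ i : Fin n, v i.succ = v i.castSucc * (z i * q i) := fun i => by rw [hv]; rfl
  have hvu : ∀ i, v i ∈ unitary A := by
    intro i
    induction i using Fin.induction with
    | zero => rw [hv0]; exact one_mem _
    | succ i ih => rw [hvs]; exact mul_mem ih (hu i)
  obtain ⟨x', hx'⟩ : ∃ x' : CStarMatrix (Fin (n + 1)) (Fin (n + 1)) A,
      x' = CStarMatrix.ofMatrix (Matrix.of fun i j =>
        if h : ∃ k : Fin n, k.castSucc = i ∧ k.succ = j then z h.choose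
        else if h : ∃ k : Fin n, k.castSucc = j ∧ k.succ = i then star (z h.choose)
        else x i j) := ⟨_, rfl⟩
  have hup : ∀ k : Fin n, x' k.castSucc k.succ = z k := by
    intro k
    have hex : ∃ l : Fin n, l.castSucc = k.castSucc ∧ l.succ = k.succ := ⟨k, rfl, rfl⟩
    have : hex.choose = k := Fin.succ_injective _ hex.choose_spec.2
    rw [hx', CStarMatrix.ofMatrix_apply, Matrix.of_apply, dif_pos hex, this]
  have hdown : ∀ k : Fin n, x' k.succ k.castSucc = star (z k) := by
    intro k
    have hex : ∃ l : Fin n, l.castSucc = k.castSucc ∧ l.succ = k.succ := ⟨k, rfl, rfl⟩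
    have hnex : ¬ ∃ l : Fin n, l.castSucc = k.succ ∧ l.succ = k.castSucc := by
      rintro ⟨l, h1, h2⟩
      have h1 := congrArg Fin.val h1
      have h2 := congrArg Fin.val h2
      simp at h1 h2
      omega
    have : hex.choose = k := Fin.succ_injective _ hex.choose_spec.2
    rw [hx', CStarMatrix.ofMatrix_apply, Matrix.of_apply, dif_neg hnex, dif_pos hex, this]
  have helse : ∀ i j, (¬ ∃ k : Fin n, k.castSucc = i ∧ k.succ = j) →
      (¬ ∃ k : Fin n, k.castSucc = j ∧ k.succ = i) → x' i j = x i j := by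
    intro i j h1 h2
    rw [hx', CStarMatrix.ofMatrix_apply, Matrix.of_apply, dif_neg h1, dif_neg h2]
  have hxs : ∀ i j, star (x j i) = x i j := fun i j => congrFun (congrFun hx.star_eq i) j
  have hx's : IsSelfAdjoint x' := by
    rw [isSelfAdjoint_iff]
    refine CStarMatrix.ext fun i j => ?_
    rw [CStarMatrix.star_apply]
    by_cases h1 : ∃ k : Fin n, k.castSucc = i ∧ k.succ = j
    · obtain ⟨k, rfl, rfl⟩ := h1
      rw [hup, hdown, star_star]
    · by_cases h2 : ∃ k : Fin n, k.castSucc = j ∧ k.succ = i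
      · obtain ⟨k, rfl, rfl⟩ := h2
        rw [hup, hdown]
      · rw [helse i j h1 h2, helse j i h2 h1, hxs]
  have hnear : ‖x - x'‖ < ε := by
    refine h _ fun i j => ?_
    rw [CStarMatrix.sub_apply]
    by_cases h1 : ∃ k : Fin n, k.castSucc = i ∧ k.succ = j
    · obtain ⟨k, rfl, rfl⟩ := h1
      rw [hup, ← dist_eq_norm]
      exact hxz k
    · by_cases h2 : ∃ k : Fin n, k.castSucc = j ∧ k.succ = i
      · obtain ⟨k, rfl, rfl⟩ := h2
        rw [hdown, ← hxs, ← star_sub, norm_star, ← dist_eq_norm]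
        exact hxz k
      · rw [helse i j h1 h2, sub_self, norm_zero]; exact hδ
  have hV := diagHom_mem_unitary hvu
  refine ⟨v, hvu, diagHom A (n + 1) v * x' * star (diagHom A (n + 1) v), hx's.conjugate _, ?_, ?_⟩
  · rw [← sub_mul, ← mul_sub, CStarRing.norm_mul_mem_unitary _ (Unitary.star_mem hV),
      CStarRing.norm_mem_unitary_mul _ hV]
    exact hnear
  · intro i
    have hval : (diagHom A (n + 1) v * x' * star (diagHom A (n + 1) v)) i.castSucc i.succ =
        v i.succ * p i * star (v i.succ) := by
      rw [← map_star, mul_diagHom_apply, diagHom_mul_apply, hup, Pi.star_apply, hvs,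
        mul_assoc (v i.castSucc) (z i * q i), mul_assoc (z i), hqp, mul_one]
    rw [hval]
    refine ⟨(hp i).conjugate _, ?_⟩
    obtain ⟨c, hc⟩ := hpos i
    refine ⟨c, ?_⟩
    have hvi := hvu i.succ
    have : v i.succ * p i * star (v i.succ) - c • (1 : A) =
        v i.succ * (p i - c • (1 : A)) * star (v i.succ) := by
      rw [mul_sub, sub_mul, mul_smul_comm, smul_mul_assoc, mul_one, (Unitary.mem_iff.1 hvi).2]
    rw [this, CStarRing.norm_mul_mem_unitary _ (Unitary.star_mem hvi),
      CStarRing.norm_mem_unitary_mul _ hvi]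
    exact hc

end MatrixAlgebra

section SeparatedSpectra

open Polynomial

variable {A : Type*} [CStarAlgebra A] {n : ℕ}

theorem abs_sub_le_of_mem_spectrum {a : A} {t r : ℝ} (ht : t ∈ spectrum ℝ a) :
    |t - r| ≤ ‖a - r • (1 : A)‖ := by
  have h1 : t - r ∈ spectrum ℝ (-(algebraMap ℝ A r) + a) := by
    rw [← spectrum.add_mem_iff, sub_add_cancel]; exact ht
  have h2 := spectrum.norm_le_norm_mul_of_mem h1
  rw [neg_add_eq_sub, Algebra.algebraMap_eq_smul_one] at h2
  have h3 := IsStarProjection.norm_le_one' (IsStarProjection.one A)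
  calc |t - r| ≤ _ := h2
    _ ≤ ‖a - r • (1 : A)‖ * 1 := by gcongr
    _ = _ := mul_one _

/-- Up to a small error, each coordinate can be separated from the others by a polynomial
without constant term. -/
def ApproxSeparated (b : Fin n → A) : Prop :=
  ∀ i, ∃ P : ℝ[X], P.eval 0 = 0 ∧
    ∀ k, ‖aeval (b k) P - (if k = i then 1 else 0 : ℝ) • (1 : A)‖ < 1 / 4

theorem isOpen_approxSeparated : IsOpen {b : Fin n → A | ApproxSeparated b} := by
  have : {b : Fin n → A | ApproxSeparated b} = ⋂ i, ⋃ P : {P : ℝ[X] // P.eval 0 = 0}, ⋂ k,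
      {b | ‖aeval (b k) P.1 - (if k = i then 1 else 0 : ℝ) • (1 : A)‖ < 1 / 4} := by
    ext b
    simp [ApproxSeparated]
  rw [this]
  refine isOpen_iInter_of_finite fun i => isOpen_iUnion fun P => isOpen_iInter_of_finite fun k => ?_
  refine isOpen_lt (Continuous.norm (Continuous.sub ?_ continuous_const)) continuous_const
  exact P.1.continuous_aeval.comp (continuous_apply k)

theorem exists_near_approxSeparated
    (hrr : ∀ a : A, IsSelfAdjoint a → a ∈ closure {x : A | IsSelfAdjoint x ∧ IsUnit x})
    (c : Fin n → A) (hc : ∀ i, IsSelfAdjoint (c i)) {ε : ℝ} (hε : 0 < ε) :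
    ∃ b : Fin n → A, (∀ i, IsSelfAdjoint (b i)) ∧ (∀ i, ‖c i - b i‖ < ε) ∧ ApproxSeparated b := by
  have hD : (⊤ : StarSubalgebra ℂ A).RealRankZero := by
    intro x _ hx δ hδ
    obtain ⟨y, ⟨hy, hyu⟩, hxy⟩ := Metric.mem_closure_iff.1 (hrr x hx) δ hδ
    exact ⟨y, StarSubalgebra.mem_top, hy, hyu, by rwa [← dist_eq_norm]⟩
  have : IsClosed ((⊤ : StarSubalgebra ℂ A) : Set A) := by simp
  obtain ⟨η, hη, hηε⟩ : ∃ η : ℝ, 0 < η ∧ 2 * (η * (n + 1)) = ε :=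
    ⟨ε / (2 * (n + 1)), by positivity, by field_simp⟩
  have hη' : 0 < η * (n + 1) := by positivity
  choose b hb hcb hspec _ using fun k : Fin n => hD.exists_near_sum_projections
    (StarSubalgebra.mem_top (x := c k)) (hc k) hη' (η * (k + 1))
  refine ⟨b, hb, fun k => hηε ▸ hcb k, ?_⟩
  have hsp : ∀ k, ∀ t ∈ spectrum ℝ (b k), ∃ z : ℤ, t = η * (k + 1 + (n + 1) * z) := by
    intro k t ht
    obtain ⟨z, hz⟩ := hspec k t ht
    exact ⟨z, by rw [hz]; ring⟩
  have hfin : ∀ k, (spectrum ℝ (b k)).Finite := by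
    intro k
    obtain ⟨R, hR⟩ : ∃ R, R = ‖b k‖ * ‖(1 : A)‖ := ⟨_, rfl⟩
    refine ((Set.finite_Icc (-⌈R / (η * (n + 1)) + 1⌉) ⌈R / (η * (n + 1)) + 1⌉).image
      fun z : ℤ => η * (k + 1 + (n + 1) * z)).subset ?_
    intro t ht
    obtain ⟨z, hz⟩ := hsp k t ht
    have h1 : |t| ≤ R := hR ▸ spectrum.norm_le_norm_mul_of_mem ht
    have h2 : (k : ℝ) + 1 ≤ n := by exact_mod_cast k.2
    have h2' : (0 : ℝ) ≤ k := by positivity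
    have h3 := Int.le_ceil (R / (η * (n + 1)) + 1)
    have h4 : |(z : ℝ)| ≤ R / (η * (n + 1)) + 1 := by
      have h5 : (z : ℝ) = t / (η * (n + 1)) - (k + 1) / (n + 1) := by
        rw [hz]; field_simp; ring
      have h6 : |t / (η * (n + 1))| ≤ R / (η * (n + 1)) := by
        rw [abs_div, abs_of_pos hη']; gcongr
      have h7 : |((k : ℝ) + 1) / (n + 1)| ≤ 1 := by
        rw [abs_of_nonneg (by positivity), div_le_one (by positivity)]; linarith
      rw [h5]
      exact (abs_sub _ _).trans (add_le_add h6 h7)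
    rw [abs_le] at h4
    refine ⟨z, ⟨?_, ?_⟩, hz.symm⟩
    · have : -(⌈R / (η * (n + 1)) + 1⌉ : ℝ) ≤ z := by linarith
      exact_mod_cast this
    · have : (z : ℝ) ≤ ⌈R / (η * (n + 1)) + 1⌉ := by linarith
      exact_mod_cast this
  have hn0 : ∀ (k : Fin n), (0 : ℝ) ∉ spectrum ℝ (b k) := by
    intro k h0
    obtain ⟨z, hz⟩ := hsp k 0 h0
    have h1 : ((k : ℝ) + 1 + (n + 1) * z) = 0 := by
      simpa [hη.ne'] using hz.symm
    have h2 : ((k : ℤ) + 1 + (n + 1) * z) = 0 := by exact_mod_cast h1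
    have h3 : ((n : ℤ) + 1) ∣ (k : ℤ) + 1 := ⟨-z, by linarith⟩
    have h4 := Int.le_of_dvd (by positivity) h3
    have := k.2
    omega
  have hdis : ∀ (k i : Fin n) t, t ∈ spectrum ℝ (b k) → t ∈ spectrum ℝ (b i) → k = i := by
    intro k i t hk hi
    obtain ⟨z, hz⟩ := hsp k t hk
    obtain ⟨w, hw⟩ := hsp i t hi
    have h1 : ((k : ℝ) + 1 + (n + 1) * z) = i + 1 + (n + 1) * w :=
      mul_left_cancel₀ hη.ne' (hz.symm.trans hw)
    have h2 : ((k : ℤ) + 1 + (n + 1) * z) = i + 1 + (n + 1) * w := by exact_mod_cast h1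
    have h3 : ((n : ℤ) + 1) ∣ (k : ℤ) - i := ⟨w - z, by linarith⟩
    have h4 : (k : ℤ) - i = 0 := by
      refine Int.eq_zero_of_abs_lt_dvd h3 ?_
      have := k.2
      have := i.2
      rw [abs_lt]
      omega
    exact Fin.ext (by omega)
  intro i
  classical
  obtain ⟨T, hT⟩ : ∃ T : Finset ℝ, ∀ t, t ∈ T ↔ t = 0 ∨ ∃ k, t ∈ spectrum ℝ (b k) :=
    ⟨insert 0 (Finset.univ.biUnion fun k => (hfin k).toFinset), by simp⟩
  refine ⟨Lagrange.interpolate T id fun t => if t ∈ spectrum ℝ (b i) then 1 else 0, ?_, ?_⟩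
  · have := Lagrange.eval_interpolate_at_node (s := T) (v := id)
      (fun t => if t ∈ spectrum ℝ (b i) then (1 : ℝ) else 0) (Set.injOn_id _)
      ((hT 0).2 (Or.inl rfl))
    rw [if_neg (hn0 i)] at this
    exact this
  · intro k
    rw [← cfc_polynomial _ (b k) (hb k)]
    have : cfc (fun t => eval t (Lagrange.interpolate T id
        fun t => if t ∈ spectrum ℝ (b i) then (1 : ℝ) else 0)) (b k) =
        cfc (fun _ => if k = i then (1 : ℝ) else 0) (b k) := by
      refine cfc_congr fun t ht => ?_
      have h1 := Lagrange.eval_interpolate_at_node (s := T) (v := id)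
        (fun t => if t ∈ spectrum ℝ (b i) then (1 : ℝ) else 0) (Set.injOn_id _)
        ((hT t).2 (Or.inr ⟨k, ht⟩))
      refine h1.trans ?_
      by_cases hki : k = i
      · subst hki; simp [ht]
      · rw [if_neg hki, if_neg fun h => hki (hdis k i t ht h)]
    rw [this, cfc_const _ (b k) (hb k), Algebra.algebraMap_eq_smul_one, sub_self, norm_zero]
    norm_num

/-- The coordinate projections lie in the (nonunital) algebra generated by a separated tuple. -/
theorem single_one_mem_of_approxSeparated {b : Fin n → A} (hb : ∀ i, IsSelfAdjoint (b i))
    (hsep : ApproxSeparated b) (C : NonUnitalStarSubalgebra ℂ (Fin n → A))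
    [IsClosed (C : Set (Fin n → A))] (hbC : b ∈ C) (i : Fin n) : Pi.single i 1 ∈ C := by
  obtain ⟨P, hP0, hP⟩ := hsep i
  obtain ⟨f, hf⟩ : ∃ f : ℝ → ℝ, f = fun t => if P.eval t < 1 / 2 then 0 else 1 := ⟨_, rfl⟩
  have hval : ∀ k, ∀ t ∈ spectrum ℝ (b k), |P.eval t - if k = i then 1 else 0| < 1 / 4 := by
    intro k t ht
    refine (abs_sub_le_of_mem_spectrum ?_).trans_lt (hP k)
    exact spectrum.subset_polynomial_aeval _ _ ⟨t, ht, rfl⟩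
  have hcont : ∀ t, P.eval t ≠ 1 / 2 → ContinuousAt f t := by
    intro t ht
    have hPc : Filter.Tendsto (fun s => P.eval s) (nhds t) (nhds (P.eval t)) :=
      P.continuous.tendsto t
    rw [hf]
    rcases lt_or_gt_of_ne ht with h | h
    · refine (continuousAt_const (y := (0 : ℝ))).congr ?_
      filter_upwards [hPc.eventually (gt_mem_nhds h)] with s hs
      rw [if_pos hs]
    · refine (continuousAt_const (y := (1 : ℝ))).congr ?_
      filter_upwards [hPc.eventually (lt_mem_nhds h)] with s hs
      rw [if_neg hs.not_gt]
  have hf0 : f 0 = 0 := by rw [hf]; simp [hP0]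
  have hspec : ∀ k, ∀ t ∈ spectrum ℝ (b k), P.eval t ≠ 1 / 2 ∧ f t = if k = i then 1 else 0 := by
    intro k t ht
    have h := hval k t ht
    rw [hf]
    by_cases hki : k = i
    · simp only [hki, if_true] at h ⊢
      rw [abs_lt] at h
      refine ⟨by linarith, if_neg (by linarith)⟩
    · simp only [hki, if_false] at h ⊢
      rw [abs_lt] at h
      refine ⟨by linarith, if_pos (by linarith)⟩
  have hq : ∀ k, ContinuousOn f (quasispectrum ℝ (b k)) := by
    intro k t ht
    refine (hcont t ?_).continuousWithinAt
    rw [quasispectrum_eq_spectrum_union_zero] at ht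
    rcases ht with ht | ht
    · exact (hspec k t ht).1
    · rw [Set.mem_singleton_iff.1 ht, hP0]; norm_num
  have hq' : ContinuousOn f (⋃ k, quasispectrum ℝ (b k)) := by
    intro t ht
    obtain ⟨k, ht⟩ := Set.mem_iUnion.1 ht
    refine (hcont t ?_).continuousWithinAt
    rw [quasispectrum_eq_spectrum_union_zero] at ht
    rcases ht with ht | ht
    · exact (hspec k t ht).1
    · rw [Set.mem_singleton_iff.1 ht, hP0]; norm_num
  have hmem : cfcₙ f b ∈ C := cfcₙ_mem (s := C) f hbC
  have hbs : IsSelfAdjoint b := funext fun k => (hb k).star_eq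
  rw [cfcₙ_map_pi (S := ℝ) f b hq' hbs hb] at hmem
  convert hmem using 1
  ext k
  rw [cfcₙ_eq_cfc (hq k) hf0, cfc_congr (g := fun _ => if k = i then 1 else 0)
    fun t ht => (hspec k t ht).2, cfc_const _ (b k) (hb k)]
  by_cases hki : k = i
  · subst hki; simp
  · simp [hki]

end SeparatedSpectra

section MatrixGeneration

attribute [local instance] CStarAlgebra.spectralOrder CStarAlgebra.spectralOrderedRing

variable {A : Type*} [CStarAlgebra A] {n : ℕ}

/-- A self-adjoint element with spectrum in the open right half line is the square root of its
square. -/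
theorem cfc_inv_sqrt_mul_self_mul {x : A} (hx : IsSelfAdjoint x) {c : ℝ}
    (hc : ‖x - c • (1 : A)‖ < c) : cfc (fun t : ℝ => (√t)⁻¹) (x * x) * x = 1 := by
  have hpos : ∀ t ∈ spectrum ℝ x, 0 < t := fun t ht => by
    have := (abs_lt.1 ((abs_sub_le_of_mem_spectrum (r := c) ht).trans_lt hc)).1
    linarith
  have hsq : cfc (fun t : ℝ => t * t) x = x * x := by
    rw [cfc_mul (fun t : ℝ => t) (fun t => t) x, cfc_id' ℝ x]
  have hcont : ContinuousOn (fun t : ℝ => (√t)⁻¹)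
      (Set.image (fun t : ℝ => t * t) (spectrum ℝ x)) := by
    rintro _ ⟨t, ht, rfl⟩
    refine ContinuousAt.continuousWithinAt ?_
    refine Real.continuous_sqrt.continuousAt.inv₀ ?_
    rw [Real.sqrt_mul_self (hpos t ht).le]
    exact (hpos t ht).ne'
  have hcomp : cfc (fun t : ℝ => (√(t * t))⁻¹) x = cfc (fun t : ℝ => (√t)⁻¹) (x * x) := by
    rw [cfc_comp' (fun t : ℝ => (√t)⁻¹) (fun t => t * t) x hcont, hsq]
  have hcont' : ContinuousOn (fun t : ℝ => (√(t * t))⁻¹) (spectrum ℝ x) :=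
    hcont.comp (f := fun t : ℝ => t * t) (by fun_prop) fun t ht => ⟨t, ht, rfl⟩
  have hmul : cfc (fun t : ℝ => (√(t * t))⁻¹ * t) x = cfc (fun _ => (1 : ℝ)) x :=
    cfc_congr fun t ht => by
      rw [Real.sqrt_mul_self (hpos t ht).le, inv_mul_cancel₀ (hpos t ht).ne']
  rw [cfc_mul _ _ x hcont', cfc_id' ℝ x, hcomp, cfc_const_one ℝ x] at hmul
  exact hmul

/-- The matrix with a single nonzero entry. -/
def singleEntry (i j : Fin n) (a : A) : CStarMatrix (Fin n) (Fin n) A :=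
  CStarMatrix.ofMatrix (Matrix.single i j a)

theorem singleEntry_mul_singleEntry (i j k : Fin n) (a b : A) :
    singleEntry i j a * singleEntry j k b = singleEntry i k (a * b) :=
  Matrix.single_mul_single_same _ _ _ _ _

theorem star_singleEntry (i j : Fin n) (a : A) :
    star (singleEntry i j a) = singleEntry j i (star a) :=
  Matrix.conjTranspose_single _ _ _

theorem singleEntry_add (i j : Fin n) (a b : A) :
    singleEntry i j (a + b) = singleEntry i j a + singleEntry i j b :=
  Matrix.single_add _ _ _ _

theorem singleEntry_smul (i j : Fin n) (r : ℂ) (a : A) :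
    singleEntry i j (r • a) = r • singleEntry i j a :=
  (Matrix.smul_single _ _ _ _).symm

theorem diagHom_single (i : Fin n) (a : A) :
    diagHom A n (Pi.single i a) = singleEntry i i a :=
  Matrix.diagonal_single _ _

theorem singleEntry_one_mul_mul (y : CStarMatrix (Fin n) (Fin n) A) (i j : Fin n) :
    singleEntry i i 1 * y * singleEntry j j 1 = singleEntry i j (y i j) :=
  (Matrix.single_mul_mul_single _ _ _ _ _ _ _).trans (by simp; rfl)

theorem sum_singleEntry (y : CStarMatrix (Fin n) (Fin n) A) :
    y = ∑ i, ∑ j, singleEntry i j (y i j) :=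
  Matrix.matrix_eq_sum_single _

theorem continuous_singleEntry (i j : Fin n) : Continuous (singleEntry i j : A → _) := by
  have : Continuous (fun a : A => Matrix.single i j a) := by
    refine continuous_pi fun k => continuous_pi fun l => ?_
    simp only [Matrix.single_apply]
    split_ifs <;> fun_prop
  exact this

/-- The coefficients occurring in a diagonal corner of a `*`-algebra of matrices. -/
def cornerSubalgebra (B : NonUnitalStarSubalgebra ℂ (CStarMatrix (Fin n) (Fin n) A)) (i : Fin n)
    (h : singleEntry i i 1 ∈ B) : StarSubalgebra ℂ A where
  carrier := {a | singleEntry i i a ∈ B}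
  mul_mem' {a b} ha hb := by
    have := B.mul_mem ha hb
    rwa [singleEntry_mul_singleEntry] at this
  add_mem' {a b} ha hb := by
    have := B.add_mem ha hb
    rwa [← singleEntry_add] at this
  algebraMap_mem' r := by
    have := SMulMemClass.smul_mem (s := B) r h
    rwa [← singleEntry_smul, ← Algebra.algebraMap_eq_smul_one] at this
  star_mem' {a} ha := by
    have h : star (singleEntry i i a) ∈ B := B.star_mem' ha
    rwa [star_singleEntry] at h

theorem mem_cornerSubalgebra
    {B : NonUnitalStarSubalgebra ℂ (CStarMatrix (Fin n) (Fin n) A)} {i : Fin n}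
    {h : singleEntry i i 1 ∈ B} {a : A} :
    a ∈ cornerSubalgebra B i h ↔ singleEntry i i a ∈ B := Iff.rfl

theorem isClosed_cornerSubalgebra
    {B : NonUnitalStarSubalgebra ℂ (CStarMatrix (Fin n) (Fin n) A)}
    (hB : IsClosed (B : Set (CStarMatrix (Fin n) (Fin n) A))) {i : Fin n}
    (h : singleEntry i i 1 ∈ B) : IsClosed (cornerSubalgebra B i h : Set A) :=
  hB.preimage (continuous_singleEntry i i)

theorem eq_top_of_mem_diagHom_of_mem
    {B : NonUnitalStarSubalgebra ℂ (CStarMatrix (Fin (n + 1)) (Fin (n + 1)) A)}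
    (hB : IsClosed (B : Set (CStarMatrix (Fin (n + 1)) (Fin (n + 1)) A)))
    {b : Fin (n + 1) → A} (hb : ∀ i, IsSelfAdjoint (b i)) (hsep : ApproxSeparated b)
    (hbB : diagHom A (n + 1) b ∈ B)
    {g : CStarMatrix (Fin (n + 1)) (Fin (n + 1)) A} (hgB : g ∈ B)
    (hg : ∀ i : Fin n, IsSelfAdjoint (g i.castSucc i.succ))
    (hg' : ∀ i : Fin n, ∃ c : ℝ, ‖g i.castSucc i.succ - c • (1 : A)‖ < c)
    (hgen : ∀ C : NonUnitalStarSubalgebra ℂ A, IsClosed (C : Set A) →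
      (∀ y ∈ B, ∀ i j, y i j ∈ C) → C = ⊤) : B = ⊤ := by
  have hdiag : ∀ i, singleEntry i i 1 ∈ B := by
    intro i
    have hcont : Continuous (diagHom A (n + 1)) := by
      have : Continuous fun c : Fin (n + 1) → A => Matrix.diagonal c :=
        Continuous.matrix_diagonal continuous_id
      exact this
    have : IsClosed ((B.comap (diagHom A (n + 1)) : NonUnitalStarSubalgebra ℂ _) : Set
      (Fin (n + 1) → A)) := hB.preimage hcont
    have h := single_one_mem_of_approxSeparated hb hsep (B.comap (diagHom A (n + 1))) hbB i
    rw [← diagHom_single]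
    exact h
  have hentry : ∀ y ∈ B, ∀ i j, singleEntry i j (y i j) ∈ B := fun y hy i j => by
    rw [← singleEntry_one_mul_mul]
    exact B.mul_mem (B.mul_mem (hdiag i) hy) (hdiag j)
  have hsucc : ∀ i : Fin n, singleEntry i.castSucc i.succ (1 : A) ∈ B := by
    intro i
    obtain ⟨c, hc⟩ := hg' i
    have hx := hg i
    have h1 := hentry g hgB i.castSucc i.succ
    have hcl := isClosed_cornerSubalgebra hB (hdiag i.castSucc)
    have h2 : g i.castSucc i.succ * g i.castSucc i.succ ∈
        cornerSubalgebra B i.castSucc (hdiag _) := by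
      have := mul_mem h1 (star_mem h1)
      rwa [star_singleEntry, hx.star_eq, singleEntry_mul_singleEntry] at this
    have h3 := cfc_mem (s := cornerSubalgebra B i.castSucc (hdiag _))
      (fun t : ℝ => (√t)⁻¹) h2
    have h4 := B.mul_mem (mem_cornerSubalgebra.1 h3) h1
    rwa [singleEntry_mul_singleEntry, cfc_inv_sqrt_mul_self_mul hx hc] at h4
  have hrow : ∀ j, singleEntry 0 j (1 : A) ∈ B := by
    intro j
    induction j using Fin.induction with
    | zero => exact hdiag 0
    | succ i ih =>
      have := B.mul_mem ih (hsucc i)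
      rwa [singleEntry_mul_singleEntry, one_mul] at this
  have hcol : ∀ j, singleEntry j 0 (1 : A) ∈ B := by
    intro j
    have := star_mem (hrow j)
    rwa [star_singleEntry, star_one] at this
  have htop : ∀ a : A, singleEntry 0 0 a ∈ B := by
    intro a
    obtain ⟨C, hC⟩ : ∃ C : NonUnitalStarSubalgebra ℂ A, ∀ a, a ∈ C ↔ singleEntry 0 0 a ∈ B :=
      ⟨(cornerSubalgebra B 0 (hdiag 0)).toNonUnitalStarSubalgebra, fun _ => Iff.rfl⟩
    have hCcl : IsClosed (C : Set A) := by
      have : (C : Set A) = cornerSubalgebra B 0 (hdiag 0) := Set.ext hC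
      rw [this]
      exact isClosed_cornerSubalgebra hB _
    have := hgen C hCcl fun y hy i j => (hC _).2 <| by
      have := B.mul_mem (B.mul_mem (hrow i) (hentry y hy i j)) (hcol j)
      rwa [singleEntry_mul_singleEntry, singleEntry_mul_singleEntry, one_mul, mul_one] at this
    rw [← hC, this]
    trivial
  refine eq_top_iff.2 fun y _ => ?_
  rw [sum_singleEntry y]
  refine sum_mem fun i _ => sum_mem fun j _ => ?_
  have := B.mul_mem (B.mul_mem (hcol i) (htop (y i j))) (hrow j)
  rwa [singleEntry_mul_singleEntry, singleEntry_mul_singleEntry, one_mul, mul_one] at this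

end MatrixGeneration

section GeneratorRank

attribute [local instance] CStarAlgebra.spectralOrder CStarAlgebra.spectralOrderedRing

variable {A : Type*} [CStarAlgebra A] {n m : ℕ}

/-- Self-adjoint families which lie in no proper closed `*`-subalgebra. -/
def selfAdjointGenerators (ι A : Type*) [NonUnitalCStarAlgebra A] : Set (ι → A) :=
  {q | (∀ i, IsSelfAdjoint (q i)) ∧ ∀ C : NonUnitalStarSubalgebra ℂ A, IsClosed (C : Set A) →
    (∀ i, q i ∈ C) → C = ⊤}

theorem mem_closure_selfAdjointGenerators_of_equiv {k : ℕ} {ι : Type*} (e : ι ≃ Fin k)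
    (h : ∀ a : Fin k → A, (∀ i, IsSelfAdjoint (a i)) →
      a ∈ closure {b : Fin k → A | (∀ i, IsSelfAdjoint (b i)) ∧ Generates b})
    (p : ι → A) (hp : ∀ i, IsSelfAdjoint (p i)) : p ∈ closure (selfAdjointGenerators ι A) := by
  have hc : Continuous fun b : Fin k → A => b ∘ e := by fun_prop
  have := map_mem_closure hc (h (p ∘ e.symm) fun i => hp _) (t := selfAdjointGenerators ι A) <| by
    rintro b ⟨hb, hgen⟩
    refine ⟨fun i => hb _, fun C hC hbC => ?_⟩
    refine eq_top_iff.2 (hgen.symm.le.trans ?_)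
    refine NonUnitalStarSubalgebra.topologicalClosure_minimal _
      (NonUnitalStarAlgebra.adjoin_le ?_) hC
    rintro _ ⟨i, rfl⟩
    simpa using hbC (e.symm i)
  simpa [Function.comp_assoc] using this

/-- Parameters for a diagonal matrix together with self-adjoint matrices, the first of which
has self-adjoint superdiagonal. -/
abbrev ParamIndex (n m : ℕ) : Type := Option (Fin (m + 1) × Fin (n + 1) × Fin (n + 1))

/-- The diagonal described by a family of parameters. -/
def paramDiag (q : ParamIndex n m → A) (i : Fin (n + 1)) : A :=
  Fin.cases (q none) (fun k => q (some (0, k.succ, k.castSucc))) i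

/-- The imaginary part of an entry above the diagonal described by a family of parameters. -/
def paramIm (q : ParamIndex n m → A) (j : Fin (m + 1)) (i k : Fin (n + 1)) : A :=
  if j = 0 ∧ (k : ℕ) = i + 1 then 0 else q (some (j, k, i))

/-- The self-adjoint matrices described by a family of parameters. -/
def paramMatrix (q : ParamIndex n m → A) (j : Fin (m + 1)) :
    CStarMatrix (Fin (n + 1)) (Fin (n + 1)) A :=
  CStarMatrix.ofMatrix <| Matrix.of fun i k =>
    if i = k then q (some (j, i, i)) else
    if i < k then q (some (j, i, k)) + Complex.I • paramIm q j i k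
    else q (some (j, k, i)) - Complex.I • paramIm q j k i

theorem paramMatrix_self (q : ParamIndex n m → A) (j : Fin (m + 1)) (i : Fin (n + 1)) :
    paramMatrix q j i i = q (some (j, i, i)) := if_pos rfl

theorem paramMatrix_of_lt (q : ParamIndex n m → A) (j : Fin (m + 1)) {i k : Fin (n + 1)}
    (h : i < k) : paramMatrix q j i k = q (some (j, i, k)) + Complex.I • paramIm q j i k :=
  (if_neg h.ne).trans (if_pos h)

theorem paramMatrix_of_gt (q : ParamIndex n m → A) (j : Fin (m + 1)) {i k : Fin (n + 1)}
    (h : k < i) : paramMatrix q j i k = q (some (j, k, i)) - Complex.I • paramIm q j k i :=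
  (if_neg h.ne').trans (if_neg h.not_gt)

theorem continuous_paramDiag :
    Continuous fun q : ParamIndex n m → A => paramDiag q := by
  refine continuous_pi fun i => ?_
  cases i using Fin.cases with
  | zero => exact continuous_apply _
  | succ i => exact continuous_apply _

theorem continuous_paramMatrix (j : Fin (m + 1)) :
    Continuous fun q : ParamIndex n m → A => paramMatrix q j := by
  have him : ∀ i k, Continuous fun q : ParamIndex n m → A => paramIm q j i k := by
    intro i k
    unfold paramIm
    split_ifs <;> fun_prop
  have : Continuous fun (q : ParamIndex n m → A) (i k : Fin (n + 1)) => paramMatrix q j i k := by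
    refine continuous_pi fun i => continuous_pi fun k => ?_
    rcases lt_trichotomy i k with h | rfl | h
    · simp_rw [paramMatrix_of_lt _ _ h]
      have := him i k
      fun_prop
    · simp_rw [paramMatrix_self]
      fun_prop
    · simp_rw [paramMatrix_of_gt _ _ h]
      have := him k i
      fun_prop
  exact this

theorem isSelfAdjoint_paramDiag {q : ParamIndex n m → A} (hq : ∀ s, IsSelfAdjoint (q s))
    (i : Fin (n + 1)) : IsSelfAdjoint (paramDiag q i) := by
  cases i using Fin.cases with
  | zero => exact hq _
  | succ i => exact hq _

theorem isSelfAdjoint_paramIm {q : ParamIndex n m → A} (hq : ∀ s, IsSelfAdjoint (q s))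
    (j : Fin (m + 1)) (i k : Fin (n + 1)) : IsSelfAdjoint (paramIm q j i k) := by
  unfold paramIm
  split_ifs
  · exact IsSelfAdjoint.zero _
  · exact hq _

theorem isSelfAdjoint_paramMatrix {q : ParamIndex n m → A} (hq : ∀ s, IsSelfAdjoint (q s))
    (j : Fin (m + 1)) : IsSelfAdjoint (paramMatrix q j) := by
  refine CStarMatrix.ext fun i k => ?_
  rw [CStarMatrix.star_apply]
  rcases lt_trichotomy i k with h | rfl | h
  · rw [paramMatrix_of_lt _ _ h, paramMatrix_of_gt _ _ h, star_sub, star_smul, (hq _).star_eq,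
      (isSelfAdjoint_paramIm hq _ _ _).star_eq]
    simp
  · rw [paramMatrix_self, (hq _).star_eq]
  · rw [paramMatrix_of_lt _ _ h, paramMatrix_of_gt _ _ h, star_add, star_smul, (hq _).star_eq,
      (isSelfAdjoint_paramIm hq _ _ _).star_eq]
    simp [sub_eq_add_neg]

theorem paramMatrix_superdiagonal (q : ParamIndex n m → A) (i : Fin n) :
    paramMatrix q 0 i.castSucc i.succ = q (some (0, i.castSucc, i.succ)) := by
  rw [paramMatrix_of_lt _ _ i.castSucc_lt_succ, paramIm, if_pos (by simp), smul_zero, add_zero]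

/-- All parameters lie in every `*`-algebra containing the entries they describe. -/
theorem mem_of_paramDiag_mem_of_paramMatrix_mem {q : ParamIndex n m → A}
    {C : NonUnitalStarSubalgebra ℂ A} (hd : ∀ i, paramDiag q i ∈ C)
    (hM : ∀ j i k, paramMatrix q j i k ∈ C) (s : ParamIndex n m) : q s ∈ C := by
  have hlt : ∀ j, ∀ {i k}, i < k → q (some (j, i, k)) ∈ C ∧ paramIm q j i k ∈ C := by
    intro j i k h
    have h1 := hM j i k
    have h2 := hM j k i
    rw [paramMatrix_of_lt _ _ h] at h1
    rw [paramMatrix_of_gt _ _ h] at h2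
    have h3 := SMulMemClass.smul_mem (s := C) (1 / 2 : ℂ) (add_mem h1 h2)
    have h4 := SMulMemClass.smul_mem (s := C) (-Complex.I / 2 : ℂ) (sub_mem h1 h2)
    constructor
    · convert h3 using 1
      module
    · convert h4 using 1
      match_scalars
      · linear_combination Complex.I_sq
      · ring
  match s with
  | none => exact hd 0
  | some (j, i, k) =>
    rcases lt_trichotomy i k with h | rfl | h
    · exact (hlt j h).1
    · exact paramMatrix_self q j i ▸ hM j i i
    · by_cases hjk : j = 0 ∧ (i : ℕ) = k + 1
      · obtain ⟨rfl, hik⟩ := hjk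
        obtain ⟨l, hl⟩ : ∃ l : Fin n, (l : ℕ) = k := ⟨⟨k, by omega⟩, rfl⟩
        have hi : i = l.succ := Fin.ext (by simp [hl, hik])
        have hk : k = l.castSucc := Fin.ext (by simp [hl])
        subst hi hk
        exact hd l.succ
      · have := (hlt j h).2
        rwa [paramIm, if_neg hjk] at this

theorem exists_param {c : Fin (n + 1) → A} (hc : ∀ i, IsSelfAdjoint (c i))
    {y : Fin (m + 1) → CStarMatrix (Fin (n + 1)) (Fin (n + 1)) A} (hy : ∀ j, IsSelfAdjoint (y j))
    (hy0 : ∀ i : Fin n, IsSelfAdjoint (y 0 i.castSucc i.succ)) :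
    ∃ p : ParamIndex n m → A, (∀ s, IsSelfAdjoint (p s)) ∧ paramDiag p = c ∧
      ∀ j, paramMatrix p j = y j := by
  have hstar : ∀ j i k, star (y j i k) = y j k i := fun j i k => by
    rw [← CStarMatrix.star_apply, (hy j).star_eq]
  obtain ⟨p, hp⟩ : ∃ p : ParamIndex n m → A, p = fun s => match s with
    | none => c 0
    | some (j, i, k) => if i = k then y j i i else if i < k then (realPart (y j i k) : A) else
        if j = 0 ∧ (i : ℕ) = k + 1 then c i else (imaginaryPart (y j k i) : A) := ⟨_, rfl⟩
  have hp1 : ∀ j i, p (some (j, i, i)) = y j i i := fun j i => by simp [hp]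
  have hp2 : ∀ j, ∀ {i k}, i < k → p (some (j, i, k)) = (realPart (y j i k) : A) :=
    fun j i k h => by simp [hp, h, h.ne]
  have hp3 : ∀ j, ∀ {i k}, i < k → paramIm p j i k = (imaginaryPart (y j i k) : A) := by
    intro j i k h
    unfold paramIm
    split_ifs with h1
    · obtain ⟨rfl, hik⟩ := h1
      obtain ⟨l, hl⟩ : ∃ l : Fin n, (l : ℕ) = i := ⟨⟨i, by omega⟩, rfl⟩
      have hi : i = l.castSucc := Fin.ext (by simp [hl])
      have hk : k = l.succ := Fin.ext (by simp [hl, hik])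
      subst hi hk
      simp [(hy0 l).imaginaryPart]
    · simp [hp, h.not_gt, h.ne', h1]
  refine ⟨p, ?_, ?_, ?_⟩
  · intro s
    match s with
    | none => simpa [hp] using hc 0
    | some (j, i, k) =>
      simp only [hp]
      split_ifs
      · exact hstar j i i
      · exact (realPart _).2
      · exact hc i
      · exact (imaginaryPart _).2
  · funext i
    cases i using Fin.cases with
    | zero => simp [paramDiag, hp]
    | succ i => simp [paramDiag, hp, i.castSucc_lt_succ.ne', i.castSucc_lt_succ.not_gt]
  · intro j
    refine CStarMatrix.ext fun i k => ?_
    rcases lt_trichotomy i k with h | rfl | h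
    · rw [paramMatrix_of_lt _ _ h, hp2 j h, hp3 j h, realPart_add_I_smul_imaginaryPart]
    · rw [paramMatrix_self, hp1]
    · rw [paramMatrix_of_gt _ _ h, hp2 j h, hp3 j h, ← hstar j k i]
      conv_rhs => rw [← realPart_add_I_smul_imaginaryPart (y j k i)]
      rw [star_add, star_smul, (realPart (y j k i)).2.star_eq, (imaginaryPart (y j k i)).2.star_eq]
      simp [sub_eq_add_neg]

theorem cons_diagHom_mem_closure_selfAdjointGenerators
    (h : ∀ p : ParamIndex n m → A, (∀ s, IsSelfAdjoint (p s)) →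
      p ∈ closure (selfAdjointGenerators (ParamIndex n m) A))
    {c : Fin (n + 1) → A} (hc : ∀ i, IsSelfAdjoint (c i)) (hsep : ApproxSeparated c)
    {y : Fin (m + 1) → CStarMatrix (Fin (n + 1)) (Fin (n + 1)) A} (hy : ∀ j, IsSelfAdjoint (y j))
    (hy0 : ∀ i : Fin n, IsSelfAdjoint (y 0 i.castSucc i.succ))
    (hy0' : ∀ i : Fin n, ∃ r : ℝ, ‖y 0 i.castSucc i.succ - r • (1 : A)‖ < r) :
    (Fin.cons (diagHom A (n + 1) c) y : Fin (m + 2) → _) ∈ closure (selfAdjointGenerators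
      (Fin (m + 2)) (CStarMatrix (Fin (n + 1)) (Fin (n + 1)) A)) := by
  obtain ⟨p, hp, rfl, hpy⟩ := exists_param hc hy hy0
  obtain rfl : paramMatrix p = y := funext hpy
  choose r hr using hy0'
  have hdiagc : Continuous (diagHom A (n + 1)) := by
    have : Continuous fun c : Fin (n + 1) → A => Matrix.diagonal c :=
      Continuous.matrix_diagonal continuous_id
    exact this
  have hev : ∀ᶠ q in nhds p, ApproxSeparated (paramDiag q) ∧
      ∀ i : Fin n, ‖q (some (0, i.castSucc, i.succ)) - r i • (1 : A)‖ < r i := by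
    refine (continuous_paramDiag.continuousAt.eventually
      (isOpen_approxSeparated.mem_nhds hsep)).and (Filter.eventually_all.2 fun i => ?_)
    refine ContinuousAt.eventually_lt (f := fun q : ParamIndex n m → A =>
      ‖q (some (0, i.castSucc, i.succ)) - r i • (1 : A)‖) ?_ continuousAt_const ?_
    · exact Continuous.continuousAt (by fun_prop)
    · simpa [paramMatrix_superdiagonal] using hr i
  have hcont : Continuous fun q : ParamIndex n m → A =>
      (Fin.cons (diagHom A (n + 1) (paramDiag q)) (paramMatrix q) : Fin (m + 2) → _) := by
    refine continuous_pi fun j => ?_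
    cases j using Fin.cases with
    | zero => exact hdiagc.comp continuous_paramDiag
    | succ j => exact continuous_paramMatrix j
  refine mem_closure_iff_frequently.2 (hcont.continuousAt.frequently ?_)
  refine ((mem_closure_iff_frequently.1 (h p hp)).and_eventually hev).mono ?_
  rintro q ⟨⟨hq, hgen⟩, hqs, hqr⟩
  refine ⟨fun j => ?_, fun B hB hqB => ?_⟩
  · cases j using Fin.cases with
    | zero =>
      have : IsSelfAdjoint (paramDiag q) := funext fun i => isSelfAdjoint_paramDiag hq i
      exact this.map (diagHom A (n + 1))
    | succ j => exact isSelfAdjoint_paramMatrix hq j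
  · have hd : diagHom A (n + 1) (paramDiag q) ∈ B := hqB 0
    have hM : ∀ j, paramMatrix q j ∈ B := fun j => hqB j.succ
    refine eq_top_of_mem_diagHom_of_mem hB (isSelfAdjoint_paramDiag hq) hqs hd (hM 0)
      (fun i => ?_) (fun i => ⟨r i, ?_⟩) fun C hC hBC => hgen C hC ?_
    · rw [paramMatrix_superdiagonal]
      exact hq _
    · rw [paramMatrix_superdiagonal]
      exact hqr i
    · refine mem_of_paramDiag_mem_of_paramMatrix_mem (fun i => ?_) fun j => hBC _ (hM j)
      have := hBC _ hd i i
      rwa [diagHom_apply, if_pos rfl] at this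

end GeneratorRank

section GeneratorRankMatrix

attribute [local instance] CStarAlgebra.spectralOrder CStarAlgebra.spectralOrderedRing

theorem conj_mem_selfAdjointGenerators {ι B : Type*} [CStarAlgebra B] {w : B} (hw : w ∈ unitary B)
    {g : ι → B} (hg : g ∈ selfAdjointGenerators ι B) :
    (fun i => star w * g i * w) ∈ selfAdjointGenerators ι B := by
  obtain ⟨f, hf⟩ : ∃ f : B ≃⋆ₐ[ℂ] B, ∀ x, f x = star w * x * w := by
    refine ⟨Unitary.conjStarAlgAut ℂ B (star ⟨w, hw⟩), fun x => ?_⟩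
    simp [Unitary.conjStarAlgAut_apply]
  refine ⟨fun i => ?_, fun C hC hgC => ?_⟩
  · have := (hg.1 i).map f
    rwa [hf] at this
  · have hcont : Continuous f := by
      have : (f : B → B) = fun x => star w * x * w := funext hf
      rw [this]
      fun_prop
    have h := hg.2 (C.comap (f : B →⋆ₙₐ[ℂ] B)) (hC.preimage hcont) fun i => by
      have h1 : star w * g i * w ∈ C := hgC i
      rwa [← hf] at h1
    refine eq_top_iff.2 fun x _ => ?_
    obtain ⟨y, rfl⟩ := f.surjective x
    have hy : y ∈ C.comap (f : B →⋆ₙₐ[ℂ] B) := h ▸ trivial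
    exact hy

variable {A : Type*} [CStarAlgebra A] {n m : ℕ}

theorem mem_closure_selfAdjointGenerators_matrix
    (hrr : ∀ a : A, IsSelfAdjoint a → a ∈ closure {x : A | IsSelfAdjoint x ∧ IsUnit x})
    (hsr : Dense {x : A | IsUnit x})
    (h : ∀ p : ParamIndex n m → A, (∀ s, IsSelfAdjoint (p s)) →
      p ∈ closure (selfAdjointGenerators (ParamIndex n m) A))
    (a : Fin (m + 2) → CStarMatrix (Fin (n + 1)) (Fin (n + 1)) A) (ha : ∀ i, IsSelfAdjoint (a i)) :
    a ∈ closure (selfAdjointGenerators (Fin (m + 2))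
      (CStarMatrix (Fin (n + 1)) (Fin (n + 1)) A)) := by
  rw [← isClosed_closure.closure_eq]
  refine Metric.mem_closure_iff.2 fun ε hε => ?_
  obtain ⟨u, hu, c, hc, huc⟩ := exists_unitary_conj_near_diagonal hrr (a 0) (ha 0) (half_pos hε)
  obtain ⟨v, hv, y, hy, hvy, hy0⟩ := exists_diagonal_unitary_conj_near hsr (u * a 1 * star u)
    ((ha 1).conjugate u) hε
  obtain ⟨δ, hδ, hδε⟩ := exists_norm_lt_of_entries (n + 1) A (half_pos hε)
  have hvcs : ∀ i, IsSelfAdjoint (v i * c i * star (v i)) := fun i => (hc i).conjugate (v i)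
  obtain ⟨b, hb, hvb, hbs⟩ := exists_near_approxSeparated hrr _ hvcs hδ
  obtain ⟨V, hVdef⟩ : ∃ V, V = diagHom A (n + 1) v := ⟨_, rfl⟩
  have hV : V ∈ unitary _ := hVdef ▸ diagHom_mem_unitary hv
  obtain ⟨w, hwdef⟩ : ∃ w, w = V * u := ⟨_, rfl⟩
  have hw : w ∈ unitary _ := hwdef ▸ mul_mem hV hu
  have hconj : ∀ x, w * x * star w = V * (u * x * star u) * star V := fun x => by
    rw [hwdef, star_mul]; simp only [mul_assoc]
  have hback : ∀ x z, ‖star w * z * w - x‖ = ‖w * x * star w - z‖ := fun x z => by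
    have h1 : star w * z * w - x = -(star w * (w * x * star w - z) * w) := by
      have h2 : star w * (w * x * star w) * w = x := by
        calc _ = (star w * w) * x * (star w * w) := by simp only [mul_assoc]
          _ = x := by rw [(Unitary.mem_iff.1 hw).1, one_mul, mul_one]
      rw [mul_sub, sub_mul, h2, neg_sub]
    rw [h1, norm_neg, CStarRing.norm_mul_mem_unitary _ hw,
      CStarRing.norm_mem_unitary_mul _ (Unitary.star_mem hw)]
  have h0 : ‖w * a 0 * star w - diagHom A (n + 1) b‖ < ε := by
    have h1 : ‖w * a 0 * star w - V * diagHom A (n + 1) c * star V‖ < ε / 2 := by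
      rwa [hconj, ← sub_mul, ← mul_sub, CStarRing.norm_mul_mem_unitary _ (Unitary.star_mem hV),
        CStarRing.norm_mem_unitary_mul _ hV]
    have h2 : ‖V * diagHom A (n + 1) c * star V - diagHom A (n + 1) b‖ < ε / 2 := by
      rw [hVdef, ← map_star, ← map_mul, ← map_mul, ← map_sub]
      refine hδε _ fun i j => ?_
      rw [diagHom_apply]
      split_ifs
      · exact hvb i
      · rwa [norm_zero]
    calc _ ≤ _ := norm_sub_le_norm_sub_add_norm_sub _ _ _
      _ < ε := by linarith [h1, h2]
  have h1 : ‖w * a 1 * star w - y‖ < ε := by rwa [hconj, hVdef]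
  obtain ⟨z, hz⟩ : ∃ z : Fin (m + 1) → CStarMatrix (Fin (n + 1)) (Fin (n + 1)) A,
      z = Fin.cons y fun j => w * a j.succ.succ * star w := ⟨_, rfl⟩
  have hzs : ∀ j, IsSelfAdjoint (z j) := by
    intro j
    cases j using Fin.cases with
    | zero => simpa [hz] using hy
    | succ j => simpa [hz] using (ha _).conjugate w
  have hmem := cons_diagHom_mem_closure_selfAdjointGenerators h hb hbs hzs
    (fun i => by simpa [hz] using (hy0 i).1) (fun i => by simpa [hz] using (hy0 i).2)
  have hcont : Continuous fun (g : Fin (m + 2) → CStarMatrix (Fin (n + 1)) (Fin (n + 1)) A) i =>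
      star w * g i * w := by fun_prop
  refine ⟨_, map_mem_closure hcont hmem fun g hg => conj_mem_selfAdjointGenerators hw hg, ?_⟩
  rw [dist_comm, dist_pi_lt_iff hε]
  intro i
  rw [dist_eq_norm, hback]
  cases i using Fin.cases with
  | zero => simpa using h0
  | succ i =>
    rw [Fin.cons_succ, hz]
    cases i using Fin.cases with
    | zero => simpa using h1
    | succ i => simpa using hε

end GeneratorRankMatrix

/-- Let `A` be a unital C*-algebra of real rank zero and stable rank one, and
`n, d ≥ 2`.  If `Gen_{(d-1)n²+1}(A)_sa` is dense in `A^{(d-1)n²+1}_sa`, then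
`Gen_d(M_n(A))_sa` is dense in `M_n(A)^d_sa`.  In other words, if `gr(A) ≥ 1` then
`gr(A ⊗ M_n) ≤ ⌈gr(A)/n²⌉`. -/
theorem gr_matrices_of_rr0_sr1 {A : Type*} [CStarAlgebra A]
    (hrr : ∀ a : A, IsSelfAdjoint a → a ∈ closure {x : A | IsSelfAdjoint x ∧ IsUnit x})
    (hsr : Dense {x : A | IsUnit x})
    {n d : ℕ} (hn : 2 ≤ n) (hd : 2 ≤ d)
    (h : ∀ a : Fin ((d - 1) * n ^ 2 + 1) → A, (∀ i, IsSelfAdjoint (a i)) →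
      a ∈ closure {b : Fin ((d - 1) * n ^ 2 + 1) → A |
        (∀ i, IsSelfAdjoint (b i)) ∧ Generates b}) :
    ∀ a : Fin d → Matrix (Fin n) (Fin n) A, (∀ i, IsSelfAdjoint (a i)) →
      a ∈ closure {b : Fin d → Matrix (Fin n) (Fin n) A |
        (∀ i, IsSelfAdjoint (b i)) ∧ MatGenerates b} := by
  obtain ⟨n, rfl⟩ : ∃ k, n = k + 1 := ⟨n - 1, by omega⟩
  obtain ⟨m, rfl⟩ : ∃ k, d = k + 2 := ⟨d - 2, by omega⟩
  have hcard : Fintype.card (ParamIndex n m) = (m + 2 - 1) * (n + 1) ^ 2 + 1 := by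
    simp [sq]
  intro a ha
  have key := mem_closure_selfAdjointGenerators_matrix hrr hsr
    (mem_closure_selfAdjointGenerators_of_equiv (Fintype.equivFinOfCardEq hcard) h) a ha
  refine closure_mono ?_ key
  rintro (g : Fin (m + 2) → Matrix (Fin (n + 1)) (Fin (n + 1)) A) ⟨hg, hgen⟩
  obtain ⟨C, hC⟩ : ∃ C, C = (NonUnitalStarAlgebra.adjoin ℂ (Set.range g)).topologicalClosure :=
    ⟨_, rfl⟩
  have hCcl : IsClosed (C : Set (Matrix (Fin (n + 1)) (Fin (n + 1)) A)) :=
    hC ▸ NonUnitalStarSubalgebra.isClosed_topologicalClosure _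
  have hgC : ∀ i, g i ∈ C := fun i => hC ▸ NonUnitalStarSubalgebra.le_topologicalClosure _
    (NonUnitalStarAlgebra.subset_adjoin ℂ (Set.range g) ⟨i, rfl⟩)
  exact ⟨hg, hC.symm.trans (hgen C hCcl hgC)⟩
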